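/- arXiv:2406.10192 — 2 statements merged into one kernel-verified Lean document; each statement's English description precedes it below -/
import Mathlib

section
/- For every connected simple graph G, there exists an odd 3-edge-covering of G, i.e., an assignment of nonempty subsets of {1,2,3} to the edges such that each color class induces a subgraph in which all non-isolated vertices have odd degree. -/
namespace OddCover

open Finset

set_option linter.unusedSectionVars false

variable {V : Type*} [Fintype V] [DecidableEq V]

/-- The degree of `u` in the edge set `Y`, modulo two. -/
def inc (Y : Finset (Sym2 V)) (u : V) : ZMod 2 := ∑ w, if s(u, w) ∈ Y then 1 else 0

/-- An edge set in which every non-isolated vertex has odd degree. -/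
def OddSet (Y : Finset (Sym2 V)) : Prop := ∀ u, (∀ w, s(u, w) ∉ Y) ∨ inc Y u = 1

/-- The edge set `E` is a union of three odd edge sets. -/
def Coverable (E : Finset (Sym2 V)) : Prop :=
  ∃ A₀ A₁ A₂ : Finset (Sym2 V), OddSet A₀ ∧ OddSet A₁ ∧ OddSet A₂ ∧ A₀ ∪ A₁ ∪ A₂ = E

theorem zmod_two_cases (a : ZMod 2) : a = 0 ∨ a = 1 := by decide +revert

theorem inc_symmDiff (Y Z : Finset (Sym2 V)) (u : V) :
    inc (symmDiff Y Z) u = inc Y u + inc Z u := by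
  unfold inc
  rw [← sum_add_distrib]
  refine sum_congr rfl fun w _ => ?_
  by_cases h1 : s(u, w) ∈ Y <;> by_cases h2 : s(u, w) ∈ Z <;> simp [mem_symmDiff, h1, h2]
  decide

theorem inc_union {Y Z : Finset (Sym2 V)} (h : Disjoint Y Z) (u : V) :
    inc (Y ∪ Z) u = inc Y u + inc Z u := by
  rw [← inc_symmDiff, h.symmDiff_eq_sup]; rfl

theorem inc_sdiff {Y Z : Finset (Sym2 V)} (h : Z ⊆ Y) (u : V) :
    inc (Y \ Z) u = inc Y u + inc Z u := by
  rw [← inc_symmDiff, symmDiff_of_ge h]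

theorem inc_singleton {a b : V} (hab : a ≠ b) (u : V) :
    inc {s(a, b)} u = (if u = a then 1 else 0) + (if u = b then 1 else 0) := by
  unfold inc
  by_cases h1 : u = a
  · subst h1
    simp [hab]
  · by_cases h2 : u = b
    · subst h2
      simp [h1]
    · simp [h1, h2]

theorem inc_empty (u : V) : inc (∅ : Finset (Sym2 V)) u = 0 := by simp [inc]

/-- Sums over the edges at a vertex are sums over its neighbours. -/
theorem sum_incident {M : Type*} [AddCommMonoid M] {Y : Finset (Sym2 V)} {u : V}
    (p : Sym2 V → M) :
    ∑ e ∈ Y with u ∈ e, p e = ∑ w, if s(u, w) ∈ Y then p s(u, w) else 0 := by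
  rw [← sum_filter]
  symm
  refine sum_bij (fun w _ => s(u, w)) ?_ ?_ ?_ ?_
  · intro w hw
    simpa using hw
  · intro a _ b _ h
    exact Sym2.congr_right.1 h
  · intro e he
    rw [mem_filter] at he
    obtain ⟨w, rfl⟩ := Sym2.mem_iff_exists.1 he.2
    exact ⟨w, by simpa using he.1, rfl⟩
  · intros; rfl

theorem inc_eq_card (Y : Finset (Sym2 V)) (u : V) :
    inc Y u = (#{e ∈ Y | u ∈ e} : ℕ) := by
  rw [card_eq_sum_ones, sum_incident]
  push_cast
  rfl

/-- If no nonempty subset of `F` is a cycle, then every function on `F` is a coboundary. -/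
theorem exists_potential {F : Finset (Sym2 V)} (hloop : ∀ u, s(u, u) ∉ F)
    (hF : ∀ Z ⊆ F, (∀ u, inc Z u = 0) → Z = ∅) (g : V → V → ZMod 2)
    (hg : ∀ u w, g u w = g w u) :
    ∃ f : V → ZMod 2, ∀ u w, s(u, w) ∈ F → f u + f w = g u w := by
  classical
  let d : (V → ZMod 2) →ₗ[ZMod 2] (F → ZMod 2) :=
    { toFun := fun f e => Sym2.lift ⟨fun u w => f u + f w, fun _ _ => add_comm _ _⟩ e.1
      map_add' := by
        intro f f'
        ext ⟨e, he⟩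
        induction e with | _ a b => simp; ring
      map_smul' := by
        intro c f
        ext ⟨e, he⟩
        induction e with | _ a b => simp; ring }
  have hd : ∀ f a b (h : s(a, b) ∈ F), d f ⟨s(a, b), h⟩ = f a + f b := fun _ _ _ _ => rfl
  by_cases hr : LinearMap.range d = ⊤
  · obtain ⟨f, hf⟩ := LinearMap.range_eq_top.1 hr
      (fun e => Sym2.lift ⟨g, hg⟩ e.1)
    exact ⟨f, fun u w h => by rw [← hd f u w h, hf]; rfl⟩
  · exfalso
    obtain ⟨φ, hφ, hle⟩ := Submodule.exists_le_ker_of_lt_top _ (lt_top_iff_ne_top.2 hr)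
    let Z : Finset (Sym2 V) := F.filter fun e => ∃ h : e ∈ F, φ (Pi.single ⟨e, h⟩ 1) = 1
    have hZ : Z = ∅ := by
      refine hF Z (filter_subset _ _) fun u => ?_
      have h0 : φ (d (Pi.single u 1)) = 0 := hle ⟨_, rfl⟩
      have hsum : d (Pi.single u 1) =
          ∑ e : F, (if u ∈ e.1 then (1 : ZMod 2) else 0) • Pi.single e (1 : ZMod 2) := by
        ext ⟨e, he⟩
        rw [Finset.sum_apply]
        simp only [Pi.smul_apply, Pi.single_apply, smul_eq_mul, mul_ite, mul_one, mul_zero]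
        rw [sum_ite_eq]
        simp only [mem_univ, if_true]
        induction e with
        | _ a b =>
          rw [hd]
          have hab : a ≠ b := fun h => hloop a (by rw [h] at he ⊢; exact he)
          by_cases h1 : u = a
          · subst h1; simp [Ne.symm hab]
          · by_cases h2 : u = b
            · subst h2; simp [hab]
            · simp [h1, h2, Ne.symm h1, Ne.symm h2]
      rw [hsum, map_sum] at h0
      rw [inc_eq_card, card_eq_sum_ones, ← h0]
      push_cast
      rw [sum_filter, sum_filter, ← sum_coe_sort F]
      refine sum_congr rfl fun e _ => ?_
      have : (∃ h : e.1 ∈ F, φ (Pi.single ⟨e.1, h⟩ 1) = 1) ↔ φ (Pi.single e 1) = 1 :=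
        ⟨fun ⟨_, h⟩ => h, fun h => ⟨e.2, h⟩⟩
      simp only [this, map_smul, smul_eq_mul]
      rcases zmod_two_cases (φ (Pi.single e 1)) with h | h <;> simp [h]
    apply hφ
    refine LinearMap.pi_ext' fun e => LinearMap.ext_ring ?_
    have : e.1 ∉ Z := by simp [hZ]
    simp only [Z, mem_filter, not_and, not_exists] at this
    simpa using (zmod_two_cases _).resolve_right (this e.2 e.2)

theorem zmod_two_ne {a b : ZMod 2} (h : a ≠ b) : a = b + 1 := by
  revert a b; decide

/-- The indicator of a proposition, with values in `ZMod 2`. -/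
noncomputable def bit (p : Prop) : ZMod 2 := open Classical in if p then 1 else 0

theorem bit_pos {p : Prop} (h : p) : bit p = 1 := by simp [bit, h]

theorem bit_neg {p : Prop} (h : ¬p) : bit p = 0 := by simp [bit, h]

theorem bit_eq_one {p : Prop} : bit p = 1 ↔ p := by
  by_cases h : p <;> simp [bit, h]

theorem bit_or {p q : Prop} (h : ¬(p ∧ q)) : bit (p ∨ q) = bit p + bit q := by
  by_cases h1 : p <;> by_cases h2 : q <;> simp_all [bit]

theorem inc_eq_bit (Y : Finset (Sym2 V)) (u : V) : inc Y u = ∑ w, bit (s(u, w) ∈ Y) := by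
  unfold inc bit
  exact sum_congr rfl fun w _ => by congr

theorem sum_bit_eq (a : V) (g : V → ZMod 2) : ∑ w, bit (w = a) * g w = g a := by
  rw [sum_eq_single a] <;> simp +contextual [bit]

theorem sum_bit_mem (B : Finset V) (g : V → ZMod 2) :
    ∑ w, bit (w ∈ B) * g w = ∑ w ∈ B, g w := by
  simp [bit]

/-- A two-colouring `c` of the edge set `H`, with the edges of `D` receiving both colours,
splits `H` into two odd edge sets. -/
theorem exists_oddSet_pair {H D : Finset (Sym2 V)} (hD : D ⊆ H) (c : V → V → ZMod 2)
    (hc : ∀ u w, s(u, w) ∈ H → c u w = c w u)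
    (hv : ∀ u, (∀ w, s(u, w) ∉ H) ∨
      ((∀ w, s(u, w) ∉ D) ∧ inc H u = 0 ∧ ∑ w, bit (s(u, w) ∈ H) * c u w = 1) ∨
      ((∀ w, s(u, w) ∉ D) ∧ inc H u = 1 ∧ ∃ ε, ∀ w, s(u, w) ∈ H → c u w = ε) ∨
      ∃ u', (∀ w, s(u, w) ∈ D ↔ w = u') ∧ inc H u = 1 ∧
        ∑ w, bit (s(u, w) ∈ H) * c u w = c u u') :
    ∃ A₀ A₁, OddSet A₀ ∧ OddSet A₁ ∧ A₀ ∪ A₁ = H := by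
  classical
  let A : ZMod 2 → Finset (Sym2 V) := fun i =>
    {e ∈ H | (∃ u w, e = s(u, w) ∧ c u w = i) ∨ e ∈ D}
  have hA : ∀ i u w, s(u, w) ∈ A i ↔ s(u, w) ∈ H ∧ (c u w = i ∨ s(u, w) ∈ D) := by
    intro i u w
    simp only [A, mem_filter]
    refine and_congr_right fun h => or_congr_left ⟨?_, fun h' => ⟨u, w, rfl, h'⟩⟩
    rintro ⟨u', w', he, h'⟩
    rcases Sym2.eq_iff.1 he with ⟨rfl, rfl⟩ | ⟨rfl, rfl⟩
    · exact h'
    · rw [hc _ _ h, h']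
  have hodd : ∀ i, OddSet (A i) := by
    intro i u
    rcases hv u with h | ⟨h1, h2, h3⟩ | ⟨h1, h2, ε, h3⟩ | ⟨u', h1, h2, h3⟩
    · exact Or.inl fun w hw => h w ((hA i u w).1 hw).1
    · right
      have : inc (A i) u = ∑ w, (bit (s(u, w) ∈ H) * c u w + bit (s(u, w) ∈ H) * (i + 1)) := by
        rw [inc_eq_bit]
        refine sum_congr rfl fun w _ => ?_
        rw [show (s(u, w) ∈ A i) = (s(u, w) ∈ H ∧ c u w = i) by simp [hA, h1]]
        by_cases h : s(u, w) ∈ H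
        · simp only [bit, h, true_and, if_true, one_mul]
          generalize c u w = x
          revert x i; decide
        · simp [bit, h]
      rw [this, sum_add_distrib, h3, ← sum_mul, ← inc_eq_bit, h2]; ring
    · by_cases hi : ε = i
      · right
        rw [← h2, inc_eq_bit, inc_eq_bit]
        refine sum_congr rfl fun w _ => ?_
        congr 1
        rw [hA, eq_iff_iff]
        exact ⟨fun h => h.1, fun h => ⟨h, Or.inl (by rw [h3 w h, hi])⟩⟩
      · left
        intro w hw
        rw [hA] at hw
        rcases hw with ⟨h, h' | h'⟩
        · exact hi (by rw [← h3 w h, h'])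
        · exact h1 w h'
    · right
      have : inc (A i) u = ∑ w, (bit (s(u, w) ∈ H) * c u w + bit (s(u, w) ∈ H) * (i + 1)
          + bit (w = u') * (c u w + i)) := by
        rw [inc_eq_bit]
        refine sum_congr rfl fun w _ => ?_
        rw [show (s(u, w) ∈ A i) = (s(u, w) ∈ H ∧ (c u w = i ∨ w = u')) by simp [hA, h1]]
        by_cases h : s(u, w) ∈ H
        · simp only [bit, h, true_and, if_true, one_mul]
          by_cases h' : w = u'
          · simp only [h', or_true, if_true, one_mul]
            generalize c u u' = x
            revert x i; decide
          · simp only [h', or_false, if_false, zero_mul, add_zero]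
            generalize c u w = x
            revert x i; decide
        · have : w ≠ u' := fun h' => h (hD ((h1 w).2 h'))
          simp [bit, h, this]
      rw [this, sum_add_distrib, sum_add_distrib, h3, ← sum_mul, ← inc_eq_bit, h2, sum_bit_eq]
      grind
  refine ⟨A 0, A 1, hodd 0, hodd 1, ?_⟩
  ext e
  induction e with
  | _ a b =>
    rw [mem_union, hA, hA]
    constructor
    · rintro (h | h) <;> exact h.1
    · intro h
      rcases zmod_two_cases (c a b) with h0 | h0
      · exact Or.inl ⟨h, Or.inl h0⟩
      · exact Or.inr ⟨h, Or.inl h0⟩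

/-- `J` is a subset of the loopless edge set `E` that avoids `v`, has odd degree at all other
vertices, and has the maximum number of edges among all such sets, for all choices of the
avoided vertex. -/
structure Good (E : Finset (Sym2 V)) (v : V) (J : Finset (Sym2 V)) : Prop where
  loopless : ∀ u, s(u, u) ∉ E
  sub : J ⊆ E
  zero : ∀ w, s(v, w) ∉ J
  one : ∀ u, u ≠ v → inc J u = 1
  max : ∀ x Y, Y ⊆ E → (∀ w, s(x, w) ∉ Y) → (∀ u, u ≠ x → inc Y u = 1) → #Y ≤ #J

/-- Adjacency in the complement of `J`, after removal of `v`. -/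
def Fadj (E : Finset (Sym2 V)) (v : V) (J : Finset (Sym2 V)) (u w : V) : Prop :=
  s(u, w) ∈ E \ J ∧ u ≠ v ∧ w ≠ v

variable {E J : Finset (Sym2 V)} {v : V}

theorem Fadj.symm {u w : V} (h : Fadj E v J u w) : Fadj E v J w u :=
  ⟨Sym2.eq_swap ▸ h.1, h.2.2, h.2.1⟩

/-- The number of special edges at `u`, modulo two. -/
noncomputable def spec (E : Finset (Sym2 V)) (v : V) (J : Finset (Sym2 V)) (e : V → V)
    (t : V → ZMod 2) (u : V) : ZMod 2 :=
  bit (Fadj E v J u (e u)) + bit (s(v, u) ∈ E) * t u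

/-- All edges at `u` outside `J` get the colour `f u`. -/
def Mono (E : Finset (Sym2 V)) (v : V) (J : Finset (Sym2 V)) (e : V → V)
    (t : V → ZMod 2) (u : V) : Prop :=
  ¬Fadj E v J u (e u) ∧ (s(v, u) ∈ E → t u = 0)

/-- The colour of the edge `u w`. -/
noncomputable def colour (v : V) (J : Finset (Sym2 V)) (q : V) (f t y : V → ZMod 2)
    (e : V → V) (u w : V) : ZMod 2 :=
  if u = v then f w + t w else if w = v then f u + t u else
    if s(u, w) ∈ J then (if u = q then y w else y u) else f u + bit (e u = w)

theorem Good.ne_of_mem (hG : Good E v J) {u w : V} (h : s(u, w) ∈ J) :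
    u ≠ v ∧ w ≠ v ∧ u ≠ w :=
  ⟨fun h' => hG.zero w (h' ▸ h), fun h' => hG.zero u (by rw [Sym2.eq_swap, ← h']; exact h),
    fun h' => hG.loopless w (hG.sub (h' ▸ h))⟩

theorem mem_extra {q : V} {B : Finset V} {u w : V} :
    s(u, w) ∈ B.image (fun p => s(q, p)) ↔ (w ∈ B ∧ u = q) ∨ (w = q ∧ u ∈ B) := by
  rw [mem_image]
  constructor
  · rintro ⟨p, hp, h⟩
    rcases Sym2.eq_iff.1 h with ⟨rfl, rfl⟩ | ⟨rfl, rfl⟩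
    · exact Or.inl ⟨hp, rfl⟩
    · exact Or.inr ⟨rfl, hp⟩
  · rintro (⟨h, rfl⟩ | ⟨rfl, h⟩)
    · exact ⟨w, h, rfl⟩
    · exact ⟨u, h, Sym2.eq_swap⟩

theorem Good.inc_compl (hG : Good E v J) {u : V} (hu : u ≠ v) :
    inc (E \ J) u = (∑ w, bit (Fadj E v J u w)) + bit (s(v, u) ∈ E) := by
  rw [inc_eq_bit, ← sum_bit_eq v (fun _ => bit (s(v, u) ∈ E)), ← sum_add_distrib]
  refine sum_congr rfl fun w _ => ?_
  by_cases hw : w = v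
  · subst hw
    have h0 : s(u, w) ∉ J := fun h => (hG.ne_of_mem h).2.1 rfl
    have : s(u, w) = s(w, u) := Sym2.eq_swap
    rw [← this]
    simp [bit, Fadj, h0]
  · simp [bit, Fadj, hw, hu]

section
variable {q : V} {B : Finset V} {f t y : V → ZMod 2} {e : V → V}

theorem Good.sum_colour (hG : Good E v J) (hB : ∀ p ∈ B, s(q, p) ∈ J) {u : V} (hu : u ≠ v) :
    ∑ w, bit (s(u, w) ∈ (E \ J) ∪ B.image (fun p => s(q, p))) * colour v J q f t y e u w =
      inc (E \ J) u * f u + spec E v J e t u + bit (u ∈ B) * y u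
        + bit (u = q) * ∑ p ∈ B, y p := by
  have key : ∀ w, bit (s(u, w) ∈ (E \ J) ∪ B.image (fun p => s(q, p))) *
      colour v J q f t y e u w = bit (Fadj E v J u w) * f u +
      bit (w = e u) * bit (Fadj E v J u w) + bit (w = v) * (bit (s(v, u) ∈ E) * (f u + t u)) +
      bit (w = q) * (bit (u ∈ B) * y u) + bit (w ∈ B) * (bit (u = q) * y w) := by
    intro w
    rw [mem_union, mem_extra]
    by_cases hw : w = v
    · subst hw
      have h0 : s(u, w) ∉ J := fun h => (hG.ne_of_mem h).2.1 rfl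
      have h1 : w ∉ B := fun h => (hG.ne_of_mem (hB _ h)).2.1 rfl
      have h2 : ¬(w = q ∧ u ∈ B) := fun h => (hG.ne_of_mem (hB _ h.2)).1 h.1.symm
      have h3 : bit (w = q) * (bit (u ∈ B) * y u) = 0 := by
        by_cases h4 : w = q
        · rw [bit_neg fun h => h2 ⟨h4, h⟩]; ring
        · rw [bit_neg h4]; ring
      have : s(u, w) = s(w, u) := Sym2.eq_swap
      rw [h3, ← this]
      simp [bit, Fadj, h0, h1, h2, colour, hu]
    · by_cases hJ : s(u, w) ∈ J
      · have hF : ¬Fadj E v J u w := fun h => (mem_sdiff.1 h.1).2 hJ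
        have hne := (hG.ne_of_mem hJ).2.2
        by_cases h1 : w ∈ B
        · by_cases h2 : u = q
          · subst h2
            simp [bit, hF, hJ, hw, hu, h1, colour, Ne.symm hne]
          · have : ¬(w = q) := fun h => (hG.ne_of_mem (hB _ h1)).2.2 h.symm
            simp [bit, hF, hJ, hw, h1, colour, h2, this]
        · by_cases h2 : w = q
          · by_cases h3 : u ∈ B
            · have : u ≠ q := fun h => hne (h.trans h2.symm)
              rw [h2] at hJ hw h1 hF ⊢
              simp [bit, hF, hJ, hw, hu, h1, h3, colour, this]
            · simp [bit, hF, hJ, hw, h1, h3]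
          · simp [bit, hF, hJ, hw, h1, h2]
      · have h1 : ¬(w ∈ B ∧ u = q) := fun h => hJ (h.2 ▸ hB w h.1)
        have h2 : ¬(w = q ∧ u ∈ B) := fun h => hJ (by rw [Sym2.eq_swap, h.1]; exact hB u h.2)
        have h3 : bit (w ∈ B) * (bit (u = q) * y w) = 0 := by
          by_cases h4 : u = q
          · rw [bit_neg fun h => h1 ⟨h, h4⟩]; ring
          · rw [bit_neg h4]; ring
        have h4 : bit (w = q) * (bit (u ∈ B) * y u) = 0 := by
          by_cases h4 : w = q
          · rw [bit_neg fun h => h2 ⟨h4, h⟩]; ring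
          · rw [bit_neg h4]; ring
        rw [h3, h4]
        by_cases hF : s(u, w) ∈ E
        · by_cases he : e u = w
          · simp [bit, Fadj, h1, h2, hF, hJ, hu, hw, colour, he]
          · simp [bit, Fadj, h1, h2, hF, hJ, hu, hw, colour, he, Ne.symm he]
        · simp [bit, Fadj, h1, h2, hF, hw]
  simp only [key, sum_add_distrib, sum_bit_eq, sum_bit_mem]
  rw [← sum_mul, hG.inc_compl hu, spec, ← mul_sum]
  ring

theorem Good.inc_extra (hG : Good E v J) (hB : ∀ p ∈ B, s(q, p) ∈ J) (u : V) :
    inc ((E \ J) ∪ B.image (fun p => s(q, p))) u =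
      inc (E \ J) u + bit (u ∈ B) + bit (u = q) * (#B : ZMod 2) := by
  rw [inc_union]
  · rw [add_assoc]
    congr 1
    rw [inc_eq_bit, card_eq_sum_ones]
    push_cast
    rw [mul_sum, ← sum_bit_mem B, ← sum_bit_eq q (fun _ => bit (u ∈ B)), ← sum_add_distrib]
    refine sum_congr rfl fun w _ => ?_
    rw [mem_extra, bit_or]
    · by_cases h1 : w ∈ B <;> by_cases h2 : u = q <;> by_cases h3 : w = q <;>
        by_cases h4 : u ∈ B <;> simp [bit, h1, h2, h3, h4]
    · rintro ⟨⟨h1, rfl⟩, rfl, -⟩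
      exact (hG.ne_of_mem (hB _ h1)).2.2 rfl
  · rw [disjoint_right]
    intro e he
    obtain ⟨p, hp, rfl⟩ := mem_image.1 he
    exact fun h => (mem_sdiff.1 h).2 (hB p hp)

/-- Local condition at `u` for a colouring in which the edges `q p`, `p ∈ B`, are added. -/
def LocalOK (E : Finset (Sym2 V)) (v : V) (J : Finset (Sym2 V)) (q : V) (B : Finset V)
    (f t y : V → ZMod 2) (e : V → V) (u : V) : Prop :=
  (u ≠ q ∧ ∀ w, s(u, w) ∉ E \ J) ∨
  (inc (E \ J) u + bit (u ∈ B) + bit (u = q) * (#B : ZMod 2) = 0 ∧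
    inc (E \ J) u * f u + spec E v J e t u + bit (u ∈ B) * y u
      + bit (u = q) * ∑ p ∈ B, y p = 1) ∨
  (inc (E \ J) u + bit (u ∈ B) + bit (u = q) * (#B : ZMod 2) = 1 ∧ Mono E v J e t u ∧
    (u ∈ B → y u = f u) ∧ (u = q → ∀ p ∈ B, y p = f q))

theorem Good.colour_symm (hG : Good E v J)
    (hf : ∀ u w, Fadj E v J u w → f u + bit (e u = w) = f w + bit (e w = u))
    (hB : ∀ p ∈ B, s(q, p) ∈ J) {u w : V}
    (h : s(u, w) ∈ (E \ J) ∪ B.image (fun p => s(q, p))) :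
    colour v J q f t y e u w = colour v J q f t y e w u := by
  unfold colour
  have hs : s(w, u) = s(u, w) := Sym2.eq_swap
  by_cases hu : u = v
  · by_cases hw : w = v
    · rw [hu, hw]
    · simp [hu, hw]
  · by_cases hw : w = v
    · simp [hu, hw]
    · rw [mem_union, mem_extra] at h
      rw [hs]
      by_cases hJ : s(u, w) ∈ J
      · have hne := (hG.ne_of_mem hJ).2.2
        rcases h with h | ⟨h1, rfl⟩ | ⟨rfl, h1⟩
        · exact absurd hJ (mem_sdiff.1 h).2
        · simp [hu, hw, hJ, Ne.symm hne]
        · simp [hu, hw, hJ, hne]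
      · simp only [hu, hw, hJ, if_false]
        refine hf u w ⟨?_, hu, hw⟩
        rcases h with h | ⟨h1, rfl⟩ | ⟨rfl, h1⟩
        · exact h
        · exact absurd (hB _ h1) hJ
        · rw [← hs] at hJ
          exact absurd (hB _ h1) hJ

theorem coverable_of_colour (hG : Good E v J) (q : V) (B : Finset V) (b : V)
    (f t y : V → ZMod 2) (e : V → V)
    (hf : ∀ u w, Fadj E v J u w → f u + bit (e u = w) = f w + bit (e w = u))
    (hB : ∀ p ∈ B, s(q, p) ∈ J) (hb : b ≠ v → s(v, b) ∈ E)
    (hloc : ∀ u, u ≠ v → u ≠ b → LocalOK E v J q B f t y e u)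
    (hdb : b ≠ v → inc (E \ J) b + bit (b ∈ B) + bit (b = q) * (#B : ZMod 2) = 1 ∧
      inc (E \ J) b * f b + spec E v J e t b + bit (b ∈ B) * y b
        + bit (b = q) * ∑ p ∈ B, y p = f b + t b)
    (hv : (b = v ∧ inc (E \ J) v = 0 ∧ ∑ a, bit (s(v, a) ∈ E) * (f a + t a) = 1) ∨
      (b = v ∧ inc (E \ J) v = 1 ∧ ∃ ε, ∀ a, s(v, a) ∈ E → f a + t a = ε) ∨
      (b ≠ v ∧ inc (E \ J) v = 1 ∧ ∑ a, bit (s(v, a) ∈ E) * (f a + t a) = f b + t b)) :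
    Coverable E := by
  classical
  set H := (E \ J) ∪ B.image (fun p => s(q, p)) with hH
  have hXJ : B.image (fun p => s(q, p)) ⊆ J := by
    intro e he
    obtain ⟨p, hp, rfl⟩ := mem_image.1 he
    exact hB p hp
  have hvH : ∀ w, s(v, w) ∈ H ↔ s(v, w) ∈ E := by
    intro w
    rw [hH, mem_union, mem_sdiff]
    refine ⟨?_, fun h => Or.inl ⟨h, hG.zero w⟩⟩
    rintro (h | h)
    · exact h.1
    · exact absurd (hXJ h) (hG.zero w)
  have hincv : inc H v = inc (E \ J) v := by
    rw [inc_eq_bit, inc_eq_bit]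
    refine sum_congr rfl fun w _ => ?_
    rw [hvH, mem_sdiff]
    simp [hG.zero w]
  have hsumv : ∑ w, bit (s(v, w) ∈ H) * colour v J q f t y e v w =
      ∑ a, bit (s(v, a) ∈ E) * (f a + t a) := by
    refine sum_congr rfl fun w _ => ?_
    rw [hvH]
    simp [colour]
  have hcb : b ≠ v → colour v J q f t y e b v = f b + t b := by
    intro h; simp [colour, h]
  have hcv : ∀ a, colour v J q f t y e v a = f a + t a := by
    intro a; simp [colour]
  have hsum : ∀ u, u ≠ v → _ := fun u hu =>
    hG.sum_colour (f := f) (t := t) (y := y) (e := e) hB hu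
  rw [← hH] at hsum
  let D : Finset (Sym2 V) := if b = v then ∅ else {s(v, b)}
  have hDb : b ≠ v → D = {s(v, b)} := fun h => if_neg h
  have hDv : b = v → D = ∅ := fun h => if_pos h
  have hDn : ∀ u, u ≠ v → u ≠ b → ∀ w, s(u, w) ∉ D := by
    intro u hu hub w
    by_cases h : b = v
    · simp [hDv h]
    · simp [hDb h, hu, hub]
  obtain ⟨A₀, A₁, h0, h1, h01⟩ := exists_oddSet_pair (H := H) (D := D) (by
      by_cases h : b = v
      · simp [hDv h]
      · rw [hDb h, singleton_subset_iff, hvH]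
        exact hb h) (colour v J q f t y e)
    (fun u w h => hG.colour_symm hf hB h) (by
      intro u
      by_cases hu : u = v
      · subst hu
        rw [hsumv, hincv]
        rcases hv with ⟨h1, h2, h3⟩ | ⟨h1, h2, ε, h3⟩ | ⟨h1, h2, h3⟩
        · refine Or.inr (Or.inl ⟨by simp [hDv h1], h2, h3⟩)
        · refine Or.inr (Or.inr (Or.inl ⟨by simp [hDv h1], h2, ε, fun a ha => ?_⟩))
          rw [hcv, h3 a ((hvH a).1 ha)]
        · refine Or.inr (Or.inr (Or.inr ⟨b, ?_, h2, ?_⟩))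
          · intro w
            rw [hDb h1, mem_singleton, Sym2.congr_right]
          · rw [h3, hcv]
      · rw [hsum u hu, hG.inc_extra hB]
        by_cases hub : u = b
        · subst hub
          obtain ⟨h1, h2⟩ := hdb hu
          refine Or.inr (Or.inr (Or.inr ⟨v, ?_, h1, ?_⟩))
          · intro w
            rw [hDb hu, mem_singleton, Sym2.eq_swap, Sym2.congr_left]
          · rw [h2, hcb hu]
        · have hD := hDn u hu hub
          rcases hloc u hu hub with ⟨h1, h2⟩ | ⟨h1, h2⟩ | ⟨h1, h2, h3, h4⟩
          · by_cases huB : u ∈ B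
            · refine Or.inr (Or.inr (Or.inl ⟨hD, ?_, y u, ?_⟩))
              · simp [inc, h2, h1, bit, huB]
              · intro w hw
                rw [hH, mem_union, mem_extra] at hw
                rcases hw with h | ⟨-, h⟩ | ⟨rfl, -⟩
                · exact absurd h (h2 w)
                · exact absurd h h1
                · have := hB u huB
                  rw [Sym2.eq_swap] at this
                  simp [colour, hu, (hG.ne_of_mem this).2.1, this, h1]
            · left
              intro w hw
              rw [hH, mem_union, mem_extra] at hw
              rcases hw with h | ⟨-, h⟩ | ⟨-, h⟩
              · exact h2 w h
              · exact h1 h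
              · exact huB h
          · exact Or.inr (Or.inl ⟨hD, h1, h2⟩)
          · refine Or.inr (Or.inr (Or.inl ⟨hD, h1, f u, ?_⟩))
            intro w hw
            rw [hH, mem_union, mem_extra] at hw
            by_cases hwv : w = v
            · subst hwv
              have : s(w, u) ∈ E := by
                rw [← hvH, Sym2.eq_swap, hH, mem_union, mem_extra]; exact hw
              simp [colour, hu, h2.2 this]
            rcases hw with h | ⟨hw1, rfl⟩ | ⟨rfl, hw1⟩
            · have : e u ≠ w := fun h' => h2.1 ⟨h' ▸ h, hu, h' ▸ hwv⟩
              simp [colour, hu, hwv, (mem_sdiff.1 h).2, bit, this]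
            · simp [colour, hu, hwv, hB w hw1, h4 rfl w hw1]
            · have := hB u hw1
              rw [Sym2.eq_swap] at this
              have hne := (hG.ne_of_mem this).2.2
              simp [colour, hu, hwv, this, hne, h3 hw1])
  refine ⟨A₀, A₁, J, h0, h1, fun u => ?_, ?_⟩
  · by_cases hu : u = v
    · exact Or.inl (hu ▸ hG.zero)
    · exact Or.inr (hG.one u hu)
  · rw [h01, hH, union_assoc, union_eq_right.2 hXJ, sdiff_union_of_subset hG.sub]

end

/-- Connectedness by edges outside `J`, after removal of `v`. -/
def Reach (E : Finset (Sym2 V)) (v : V) (J : Finset (Sym2 V)) : V → V → Prop :=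
  Relation.ReflTransGen (Fadj E v J)

/-- The function `k` is constant on the components of the complement of `J` minus `v`. -/
def Inv (E : Finset (Sym2 V)) (v : V) (J : Finset (Sym2 V)) (k : V → ZMod 2) : Prop :=
  ∀ u w, Fadj E v J u w → k u = k w

/-- The indicator of the component of `z`. -/
noncomputable def ind (E : Finset (Sym2 V)) (v : V) (J : Finset (Sym2 V)) (z x : V) : ZMod 2 :=
  bit (Reach E v J z x)

/-- The edges outside `J` that avoid `v`. -/
def Fset (E : Finset (Sym2 V)) (v : V) (J : Finset (Sym2 V)) : Finset (Sym2 V) :=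
  {e ∈ E \ J | v ∉ e}

theorem mem_Fset {u w : V} : s(u, w) ∈ Fset E v J ↔ Fadj E v J u w := by
  rw [Fset, mem_filter, Fadj, Sym2.mem_iff]
  tauto

theorem Reach.symm {x z : V} (h : Reach E v J x z) : Reach E v J z x := by
  induction h with
  | refl => exact Relation.ReflTransGen.refl
  | tail _ h ih => exact Relation.ReflTransGen.head h.symm ih

theorem Reach.trans {x y z : V} (h : Reach E v J x y) (h' : Reach E v J y z) :
    Reach E v J x z :=
  Relation.ReflTransGen.trans h h'

theorem Fadj.reach {x z : V} (h : Fadj E v J x z) : Reach E v J x z :=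
  Relation.ReflTransGen.single h

theorem Reach.rfl' (x : V) : Reach E v J x x := Relation.ReflTransGen.refl

theorem ind_inv (z : V) : Inv E v J (ind E v J z) := by
  intro u w h
  unfold ind
  congr 1
  exact propext ⟨fun h' => h'.trans h.reach, fun h' => h'.trans h.symm.reach⟩

theorem ind_self (z : V) : ind E v J z z = 1 := bit_pos (Reach.rfl' z)

theorem Inv.reach {k : V → ZMod 2} (hk : Inv E v J k) {x z : V} (h : Reach E v J x z) :
    k x = k z := by
  induction h with
  | refl => rfl
  | tail _ h ih => rw [ih, hk _ _ h]

theorem Good.Fset_loopless (hG : Good E v J) (u : V) : s(u, u) ∉ Fset E v J :=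
  fun h => hG.loopless u (mem_sdiff.1 (mem_Fset.1 h).1).1

theorem Good.exchange (hG : Good E v J) {R Y : Finset (Sym2 V)} (hR : R ⊆ J) (hY : Y ⊆ E \ J)
    (v' : V) (h0 : ∀ w, s(v', w) ∉ (J \ R) ∪ Y)
    (h1 : ∀ u, u ≠ v' → inc J u + inc R u + inc Y u = 1) : #Y ≤ #R := by
  have hd : Disjoint (J \ R) Y :=
    disjoint_of_subset_left sdiff_subset (disjoint_of_subset_right hY disjoint_sdiff)
  have := hG.max v' ((J \ R) ∪ Y)
    (union_subset (sdiff_subset.trans hG.sub) (hY.trans sdiff_subset)) h0 (fun u hu => by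
      rw [inc_union hd, inc_sdiff hR, h1 u hu])
  rw [card_union_of_disjoint hd, card_sdiff_of_subset hR] at this
  have := card_le_card hR
  omega

theorem Good.no_even (hG : Good E v J) (Z : Finset (Sym2 V)) (hZ : Z ⊆ Fset E v J)
    (h : ∀ u, inc Z u = 0) : Z = ∅ := by
  have hZ' : Z ⊆ E \ J := hZ.trans (filter_subset _ _)
  have := hG.exchange (empty_subset J) hZ' v (by
      intro w hw
      rw [sdiff_empty, mem_union] at hw
      rcases hw with hw | hw
      · exact hG.zero w hw
      · exact (mem_Fset.1 (hZ hw)).2.1 rfl) (by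
      intro u hu
      rw [hG.one u hu, h, inc_empty]; rfl)
  exact card_eq_zero.1 (by simpa using this)

theorem Good.potential (hG : Good E v J) (g : V → V → ZMod 2) (hg : ∀ u w, g u w = g w u) :
    ∃ f : V → ZMod 2, ∀ u w, Fadj E v J u w → f u + f w = g u w := by
  obtain ⟨f, hf⟩ := exists_potential hG.Fset_loopless hG.no_even g hg
  exact ⟨f, fun u w h => hf u w (mem_Fset.2 h)⟩

/-- `f` is a solution of the colouring constraints for the special edges given by `e`. -/
def Solves (E : Finset (Sym2 V)) (v : V) (J : Finset (Sym2 V)) (e : V → V)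
    (f : V → ZMod 2) : Prop :=
  ∀ u w, Fadj E v J u w → f u + bit (e u = w) = f w + bit (e w = u)

theorem Good.solve (hG : Good E v J) (e : V → V) : ∃ f, Solves E v J e f := by
  obtain ⟨f, hf⟩ := hG.potential (fun u w => bit (e u = w) + bit (e w = u))
    (fun _ _ => add_comm _ _)
  exact ⟨f, fun u w h => by have := hf u w h; grind⟩

theorem Solves.shift {e : V → V} {f k : V → ZMod 2} (hf : Solves E v J e f)
    (hk : Inv E v J k) : Solves E v J e (fun u => f u + k u) := by
  intro u w h
  have := hf u w h
  have := hk u w h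
  grind

theorem Good.jump (hG : Good E v J) {p w : V} (h : Fadj E v J p w) :
    ∃ g : V → ZMod 2, g p = 0 ∧ g w = 1 ∧
      ∀ u x, Fadj E v J u x → g u + g x = bit (s(u, x) = s(p, w)) := by
  obtain ⟨f, hf⟩ := hG.potential (fun u x => bit (s(u, x) = s(p, w)))
    (fun u x => by rw [Sym2.eq_swap])
  have h1 := hf p w h
  rw [bit_pos rfl] at h1
  refine ⟨fun u => f u + f p, by grind, by grind, fun u x hux => ?_⟩
  have := hf u x hux
  grind

theorem bit_pair {a b : V} (hab : a ≠ b) (u : V) :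
    inc {s(a, b)} u = bit (u = a) + bit (u = b) := by
  rw [inc_singleton hab]
  unfold bit
  congr

theorem Fadj.ne (hG : Good E v J) {u w : V} (h : Fadj E v J u w) : u ≠ w :=
  fun h' => hG.loopless w (h' ▸ (mem_sdiff.1 h.1).1)

theorem exists_chain {Y₀ : Finset (Sym2 V)} (h₀ : ∀ u, s(u, u) ∉ Y₀) {x z : V}
    (h : Relation.ReflTransGen (fun u w => s(u, w) ∈ Y₀) x z) :
    ∃ Y ⊆ Y₀, (∀ u, inc Y u = bit (u = x) + bit (u = z)) ∧
      ∀ u w, s(u, w) ∈ Y → Relation.ReflTransGen (fun u w => s(u, w) ∈ Y₀) x u := by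
  induction h with
  | refl => exact ⟨∅, empty_subset _, fun u => by rw [inc_empty]; grind, by simp⟩
  | @tail b c hxb hbc ih =>
    obtain ⟨Y, hY, h1, h2⟩ := ih
    refine ⟨symmDiff Y {s(b, c)}, ?_, ?_, ?_⟩
    · intro e he
      rcases mem_symmDiff.1 he with ⟨h, -⟩ | ⟨h, -⟩
      · exact hY h
      · rwa [mem_singleton.1 h]
    · intro u
      rw [inc_symmDiff, h1, bit_pair (by rintro rfl; exact h₀ b hbc)]
      grind
    · intro u w he
      rcases mem_symmDiff.1 he with ⟨h, -⟩ | ⟨h, -⟩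
      · exact h2 u w h
      · rcases Sym2.eq_iff.1 (mem_singleton.1 h) with ⟨rfl, rfl⟩ | ⟨rfl, rfl⟩
        · exact hxb
        · exact hxb.tail hbc

theorem Good.exists_chain (hG : Good E v J) {x z : V} (h : Reach E v J x z) :
    ∃ Y ⊆ Fset E v J, (∀ u, inc Y u = bit (u = x) + bit (u = z)) ∧
      ∀ u w, s(u, w) ∈ Y → Reach E v J x u := by
  have hr : (fun u w => s(u, w) ∈ Fset E v J) = Fadj E v J := by
    ext u w
    exact mem_Fset
  have := OddCover.exists_chain hG.Fset_loopless (x := x) (z := z) (by rwa [hr])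
  rwa [hr] at this

theorem exists_of_inc {Y : Finset (Sym2 V)} {u : V} (h : inc Y u = 1) : ∃ w, s(u, w) ∈ Y := by
  by_contra! h'
  simp [inc, h'] at h

theorem exists_ne_of_inc {Y : Finset (Sym2 V)} {u x : V} (h : inc Y u = 0) (hx : s(u, x) ∈ Y) :
    ∃ w, w ≠ x ∧ s(u, w) ∈ Y := by
  by_contra! h'
  have : ∀ w, s(u, w) ∈ Y ↔ w = x := fun w => ⟨fun hw => by_contra fun hn => h' w hn hw,
    fun hw => hw ▸ hx⟩
  simp [inc, this] at h

theorem exists_third {Y : Finset (Sym2 V)} {u x y : V} (h : inc Y u = 1) (hx : s(u, x) ∈ Y)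
    (hy : s(u, y) ∈ Y) (hxy : x ≠ y) : ∃ w, w ≠ x ∧ w ≠ y ∧ s(u, w) ∈ Y := by
  by_contra! h'
  have : ∀ w, s(u, w) ∈ Y ↔ w = x ∨ w = y := fun w =>
    ⟨fun hw => by_contra fun hn => h' w (fun h => hn (Or.inl h)) (fun h => hn (Or.inr h)) hw,
    fun hw => by rcases hw with rfl | rfl <;> assumption⟩
  have h2 : ∀ w, bit (s(u, w) ∈ Y) = bit (w = x) * 1 + bit (w = y) * 1 := fun w => by
    rw [this, bit_or]
    · ring
    · rintro ⟨rfl, h⟩; exact hxy h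
  rw [inc_eq_bit] at h
  simp only [h2, sum_add_distrib, sum_bit_eq] at h
  exact absurd h (by decide)

theorem Good.not_reach (hG : Good E v J) {a q : V} (h : s(a, q) ∈ J) : ¬Reach E v J a q := by
  intro hr
  obtain ⟨hav, hqv, hne⟩ := hG.ne_of_mem h
  obtain ⟨Y, hY, h1, -⟩ := hG.exists_chain hr
  have hc := hG.exchange (R := {s(a, q)}) (singleton_subset_iff.2 h)
    (hY.trans (filter_subset _ _)) v (by
      intro w hw
      rcases mem_union.1 hw with hw | hw
      · exact hG.zero w (mem_sdiff.1 hw).1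
      · exact (mem_Fset.1 (hY hw)).2.1 rfl) (by
      intro u hu
      rw [hG.one u hu, bit_pair hne, h1]; grind)
  rw [card_singleton, card_le_one] at hc
  obtain ⟨w, hw⟩ := exists_of_inc (Y := Y) (u := a) (by rw [h1, bit_pos rfl, bit_neg hne]; rfl)
  obtain ⟨w', hw'⟩ := exists_of_inc (Y := Y) (u := q)
    (by rw [h1, bit_pos rfl, bit_neg hne.symm]; rfl)
  have := hc _ hw _ hw'
  rcases Sym2.eq_iff.1 this with ⟨h, -⟩ | ⟨-, rfl⟩
  · exact hne h
  · exact (mem_sdiff.1 (mem_Fset.1 (hY hw)).1).2 h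

theorem Good.exists_other (hG : Good E v J) {a b q : V} (hbq : s(b, q) ∈ J) (ha : s(v, a) ∈ E)
    (haq : a ≠ q) (hr : Reach E v J a q) : ∃ q', q' ≠ q ∧ s(b, q') ∈ J := by
  by_contra! h
  obtain ⟨hbv, hqv, hne⟩ := hG.ne_of_mem hbq
  have hab : ¬Reach E v J a b := fun h' => hG.not_reach hbq (h'.symm.trans hr)
  have hba : b ≠ a := fun h' => hab (h' ▸ Reach.rfl' _)
  have hva : v ≠ a := fun h' => hG.loopless v (by nth_rw 2 [h']; exact ha)
  obtain ⟨Y, hY, h1, h2⟩ := hG.exists_chain hr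
  have hnot : s(v, a) ∉ Y := fun h' => (mem_Fset.1 (hY h')).2.1 rfl
  have hd : Disjoint ({s(v, a)} : Finset _) Y := disjoint_singleton_left.2 hnot
  have hc := hG.exchange (R := {s(b, q)}) (Y := {s(v, a)} ∪ Y) (singleton_subset_iff.2 hbq)
    (union_subset (singleton_subset_iff.2 (mem_sdiff.2 ⟨ha, hG.zero a⟩))
      (hY.trans (filter_subset _ _))) b (by
      intro w hw
      rw [mem_union, mem_sdiff, mem_singleton, mem_union, mem_singleton] at hw
      rcases hw with hw | hw | hw
      · refine h w (fun hwq => hw.2 (by rw [hwq])) hw.1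
      · rcases Sym2.eq_iff.1 hw with ⟨h, -⟩ | ⟨h, -⟩
        · exact hbv h
        · exact hba h
      · exact hab (h2 _ _ hw)) (by
      intro u hu
      rw [inc_union hd, bit_pair hne, bit_pair hva, h1, bit_neg hu]
      by_cases huv : u = v
      · have : inc J u = 0 := by
          subst huv
          simp [inc, hG.zero]
        rw [this, bit_pos huv]
        grind
      · rw [hG.one u huv, bit_neg huv]; grind)
  rw [card_singleton, card_union_of_disjoint hd, card_singleton] at hc
  have : Y = ∅ := card_eq_zero.1 (by omega)
  have h3 := h1 a
  rw [this, inc_empty, bit_pos rfl, bit_neg haq] at h3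
  exact absurd h3 (by decide)

theorem inc_two {z p₁ p₂ : V} (h1 : z ≠ p₁) (h2 : z ≠ p₂) (h : p₁ ≠ p₂) (u : V) :
    inc {s(z, p₁), s(z, p₂)} u = bit (u = p₁) + bit (u = p₂) := by
  have : ({s(z, p₁), s(z, p₂)} : Finset (Sym2 V)) = {s(z, p₁)} ∪ {s(z, p₂)} := rfl
  rw [this, inc_union, bit_pair h1, bit_pair h2]
  · grind
  · rw [disjoint_singleton, ne_eq, Sym2.congr_right]; exact h

theorem Good.short_path (hG : Good E v J) {q p₁ p₂ : V} (h₁ : s(q, p₁) ∈ J) (h₂ : s(q, p₂) ∈ J)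
    (hne : p₁ ≠ p₂) (hr : Reach E v J p₁ p₂) :
    Fadj E v J p₁ p₂ ∨ ∃ w, Fadj E v J p₁ w ∧ Fadj E v J w p₂ := by
  obtain ⟨Y, hY, h1, -⟩ := hG.exists_chain hr
  have hc := hG.exchange (R := {s(q, p₁), s(q, p₂)}) (by
      rw [insert_subset_iff, singleton_subset_iff]; exact ⟨h₁, h₂⟩)
    (hY.trans (filter_subset _ _)) v (by
      intro w hw
      rcases mem_union.1 hw with hw | hw
      · exact hG.zero w (mem_sdiff.1 hw).1
      · exact (mem_Fset.1 (hY hw)).2.1 rfl) (by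
      intro u hu
      rw [hG.one u hu, inc_two (hG.ne_of_mem h₁).2.2 (hG.ne_of_mem h₂).2.2 hne, h1]; grind)
  have hc2 : #Y ≤ 2 := hc.trans card_le_two
  obtain ⟨w, hw⟩ := exists_of_inc (Y := Y) (u := p₁) (by rw [h1, bit_pos rfl, bit_neg hne]; rfl)
  by_cases hwp : w = p₂
  · exact Or.inl (mem_Fset.1 (hY (hwp ▸ hw)))
  right
  have hw1 := mem_Fset.1 (hY hw)
  obtain ⟨x, hx1, hx⟩ := exists_ne_of_inc (Y := Y) (u := w) (x := p₁)
    (by rw [h1, bit_neg (hw1.ne hG).symm, bit_neg hwp]; rfl) (by rw [Sym2.eq_swap]; exact hw)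
  obtain ⟨y, hy⟩ := exists_of_inc (Y := Y) (u := p₂)
    (by rw [h1, bit_pos rfl, bit_neg hne.symm]; rfl)
  refine ⟨w, hw1, ?_⟩
  by_cases hxp : x = p₂
  · rw [← hxp]; exact mem_Fset.1 (hY hx)
  exfalso
  have : #({s(p₁, w), s(w, x), s(p₂, y)} : Finset (Sym2 V)) ≤ #Y := by
    refine card_le_card ?_
    intro e he
    simp only [mem_insert, mem_singleton] at he
    rcases he with rfl | rfl | rfl <;> assumption
  rw [card_eq_three.2 ⟨_, _, _, ?_, ?_, ?_, rfl⟩] at this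
  · omega
  · rw [ne_eq, Sym2.eq_iff]; grind
  · rw [ne_eq, Sym2.eq_iff]; grind
  · rw [ne_eq, Sym2.eq_iff]; grind

/-- The result of replacing the path `p₁ z p₂` in `J` by the path `p₁ w p₂`. -/
def swap (J : Finset (Sym2 V)) (z w p₁ p₂ : V) : Finset (Sym2 V) :=
  (J \ {s(z, p₁), s(z, p₂)}) ∪ {s(w, p₁), s(w, p₂)}

theorem Good.swap (hG : Good E v J) {z w p₁ p₂ : V} (h₁ : s(z, p₁) ∈ J) (h₂ : s(z, p₂) ∈ J)
    (hne : p₁ ≠ p₂) (hw₁ : Fadj E v J p₁ w) (hw₂ : Fadj E v J w p₂) :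
    Good E v (swap J z w p₁ p₂) := by
  have hsub : ({s(z, p₁), s(z, p₂)} : Finset (Sym2 V)) ⊆ J := by
    rw [insert_subset_iff, singleton_subset_iff]; exact ⟨h₁, h₂⟩
  have hsub' : ({s(w, p₁), s(w, p₂)} : Finset (Sym2 V)) ⊆ E \ J := by
    rw [insert_subset_iff, singleton_subset_iff]; exact ⟨hw₁.symm.1, hw₂.1⟩
  have hd : Disjoint (J \ {s(z, p₁), s(z, p₂)}) {s(w, p₁), s(w, p₂)} :=
    disjoint_of_subset_left sdiff_subset (disjoint_of_subset_right hsub' disjoint_sdiff)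
  have hcard : #J = #(OddCover.swap J z w p₁ p₂) := by
    rw [OddCover.swap, card_union_of_disjoint hd, card_sdiff_of_subset hsub,
      card_pair (by rw [ne_eq, Sym2.congr_right]; exact hne),
      card_pair (by rw [ne_eq, Sym2.congr_right]; exact hne)]
    have := card_le_card hsub
    rw [card_pair (by rw [ne_eq, Sym2.congr_right]; exact hne)] at this
    omega
  refine ⟨hG.loopless, ?_, ?_, ?_, ?_⟩
  · exact union_subset (sdiff_subset.trans hG.sub) (hsub'.trans sdiff_subset)
  · intro x hx
    rw [OddCover.swap, mem_union, mem_insert, mem_singleton, Sym2.eq_iff, Sym2.eq_iff] at hx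
    have := hG.zero x
    have := hw₁.2
    have := hw₂.2
    grind
  · intro u hu
    rw [OddCover.swap, inc_union hd, inc_sdiff hsub, hG.one u hu,
      inc_two (hG.ne_of_mem h₁).2.2 (hG.ne_of_mem h₂).2.2 hne,
      inc_two (hw₁.symm.ne hG) (hw₂.ne hG) hne]
    grind
  · rw [← hcard]; exact hG.max

theorem Fadj.of_swap {z w p₁ p₂ : V}
    {u x : V} (h : Fadj E v (swap J z w p₁ p₂) u x) :
    (Fadj E v J u x ∧ s(u, x) ≠ s(p₁, w) ∧ s(u, x) ≠ s(p₂, w)) ∨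
      s(u, x) = s(z, p₁) ∨ s(u, x) = s(z, p₂) := by
  obtain ⟨h1, h2⟩ := h
  rw [mem_sdiff, swap, mem_union, mem_sdiff, mem_insert, mem_singleton, mem_insert,
    mem_singleton] at h1
  rw [Fadj, mem_sdiff, Sym2.eq_swap (a := p₁), Sym2.eq_swap (a := p₂)]
  tauto

theorem Inv.swap {z w p₁ p₂ : V}
    (hne : p₁ ≠ p₂) (hw₁ : Fadj E v J p₁ w) (hw₂ : Fadj E v J w p₂)
    {k g₁ g₂ : V → ZMod 2} (hk : Inv E v J k) (hz : k z = 0)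
    (h10 : g₁ p₁ = 0) (h11 : g₁ w = 1) (h20 : g₂ p₂ = 0) (h21 : g₂ w = 1)
    (h1 : ∀ u x, Fadj E v J u x → g₁ u + g₁ x = bit (s(u, x) = s(p₁, w)))
    (h2 : ∀ u x, Fadj E v J u x → g₂ u + g₂ x = bit (s(u, x) = s(p₂, w))) :
    Inv E v (swap J z w p₁ p₂) (fun u => k u * (1 + g₁ u + g₂ u)) := by
  have e1 : g₂ p₁ = 1 := by
    have := h2 p₁ w hw₁
    rw [bit_neg (by rw [Sym2.congr_left]; exact hne)] at this
    grind
  have e2 : g₁ p₂ = 1 := by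
    have := h1 p₂ w hw₂.symm
    rw [bit_neg (by rw [Sym2.congr_left]; exact hne.symm)] at this
    grind
  intro u x h
  rcases h.of_swap with ⟨h, h3, h4⟩ | h | h
  · have a1 := h1 u x h
    have a2 := h2 u x h
    rw [bit_neg h3] at a1
    rw [bit_neg h4] at a2
    have := hk u x h
    have : g₁ u = g₁ x := by grind
    have : g₂ u = g₂ x := by grind
    simp only [*]
  · rcases Sym2.eq_iff.1 h with ⟨rfl, rfl⟩ | ⟨rfl, rfl⟩ <;> grind
  · rcases Sym2.eq_iff.1 h with ⟨rfl, rfl⟩ | ⟨rfl, rfl⟩ <;> grind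

theorem Good.inc_compl_zero (hG : Good E v J) : inc (E \ J) v = inc E v := by
  unfold inc
  refine sum_congr rfl fun w _ => ?_
  simp [hG.zero w]

/-- The local condition at a vertex not involved in any edge of `J` that gets a colour. -/
def Std (E : Finset (Sym2 V)) (v : V) (J : Finset (Sym2 V)) (e : V → V)
    (t : V → ZMod 2) (u : V) : Prop :=
  (∀ w, s(u, w) ∉ E \ J) ∨ (inc (E \ J) u = 0 ∧ spec E v J e t u = 1) ∨
    (inc (E \ J) u = 1 ∧ Mono E v J e t u)

theorem Good.not_fadj_self (hG : Good E v J) (u : V) : ¬Fadj E v J u u :=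
  fun h => h.ne hG rfl

theorem Good.spec_self (hG : Good E v J) {e : V → V} {t : V → ZMod 2} {u : V} (h : e u = u) :
    spec E v J e t u = bit (s(v, u) ∈ E) * t u := by
  rw [spec, h, bit_neg (hG.not_fadj_self u), zero_add]

theorem Good.mono_self (hG : Good E v J) {e : V → V} {t : V → ZMod 2} {u : V} (h : e u = u)
    (ht : t u = 0) : Mono E v J e t u :=
  ⟨by rw [h]; exact hG.not_fadj_self u, fun _ => ht⟩

theorem Mono.spec {e : V → V} {t : V → ZMod 2} {u : V} (h : Mono E v J e t u) :
    spec E v J e t u = 0 := by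
  rw [OddCover.spec, bit_neg h.1, zero_add]
  by_cases h1 : s(v, u) ∈ E
  · rw [h.2 h1, mul_zero]
  · rw [bit_neg h1, zero_mul]

theorem Good.exists_pattern (hG : Good E v J) (M : Finset V) (e₀ : V → V) (t₀ : V → ZMod 2) :
    ∃ (e : V → V) (t : V → ZMod 2), (∀ u ∈ M, e u = e₀ u ∧ t u = t₀ u) ∧
      ∀ u, u ∉ M → u ≠ v → Std E v J e t u := by
  have key : ∀ u, ∃ (x : V) (i : ZMod 2), u ≠ v → ∀ e t, e u = x → t u = i →
      Std E v J e t u := by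
    intro u
    rcases zmod_two_cases (inc (E \ J) u) with h | h
    · by_cases hN : s(v, u) ∈ E
      · refine ⟨u, 1, fun _ e t he ht => Or.inr (Or.inl ⟨h, ?_⟩)⟩
        rw [hG.spec_self he, bit_pos hN, ht, one_mul]
      · by_cases hF : ∃ w, Fadj E v J u w
        · obtain ⟨w, hw⟩ := hF
          refine ⟨w, 0, fun _ e t he ht => Or.inr (Or.inl ⟨h, ?_⟩)⟩
          rw [spec, he, bit_pos hw, ht]; ring
        · refine ⟨u, 0, fun hu e t he ht => Or.inl fun w hw => hF ⟨w, hw, hu, ?_⟩⟩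
          rintro rfl
          exact hN (by rw [Sym2.eq_swap]; exact (mem_sdiff.1 hw).1)
    · exact ⟨u, 0, fun _ e t he ht => Or.inr (Or.inr ⟨h, hG.mono_self he ht⟩)⟩
  choose x i hx using key
  refine ⟨fun u => if u ∈ M then e₀ u else x u, fun u => if u ∈ M then t₀ u else i u,
    fun u hu => by simp [hu], fun u hu huv => hx u huv _ _ (by simp [hu]) (by simp [hu])⟩

/-- The local condition depends only on the values at the vertex. -/
theorem Std.congr {e e' : V → V} {t t' : V → ZMod 2} {u : V} (h : Std E v J e t u)
    (he : e' u = e u) (ht : t' u = t u) : Std E v J e' t' u := by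
  unfold Std Mono spec at *
  rwa [he, ht]

theorem Solves.glue {e₁ e₂ : V → V} {f₁ f₂ : V → ZMod 2} (h₁ : Solves E v J e₁ f₁)
    (h₂ : Solves E v J e₂ f₂) (z : V) (h : ∀ u, ¬Reach E v J z u → e₁ u = e₂ u) :
    ∃ f, Solves E v J e₂ f ∧ (∀ u, Reach E v J z u → f u = f₂ u) ∧
      ∀ u, ¬Reach E v J z u → f u = f₁ u := by
  classical
  refine ⟨fun u => if Reach E v J z u then f₂ u else f₁ u, ?_, fun u hu => if_pos hu,
    fun u hu => if_neg hu⟩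
  intro u w huw
  by_cases hu : Reach E v J z u
  · simpa [hu, hu.trans huw.reach] using h₂ u w huw
  · have hw : ¬Reach E v J z w := fun h => hu (h.trans huw.symm.reach)
    simpa [hu, hw, h u hu, h w hw] using h₁ u w huw

section
variable {q : V} {B : Finset V} {f t y : V → ZMod 2} {e : V → V}

theorem Std.localOK {u : V} (h : Std E v J e t u) (hB : u ∉ B) (hq : u ≠ q) :
    LocalOK E v J q B f t y e u := by
  rcases h with h | ⟨h1, h2⟩ | ⟨h1, h2⟩
  · exact Or.inl ⟨hq, h⟩
  · exact Or.inr (Or.inl (by simp [bit, hB, hq, h1, h2]))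
  · exact Or.inr (Or.inr (by simp [bit, hB, hq, h1, h2]))

theorem Std.local_empty {u : V} (h : Std E v J e t u) (hu : u ≠ v) :
    LocalOK E v J v ∅ f t y e u := h.localOK (notMem_empty u) hu

theorem local_mem_even {u : V} (hB : u ∈ B) (hq : u ≠ q)
    (hu : inc (E \ J) u = 0) (hm : Mono E v J e t u) (hy : y u = f u) :
    LocalOK E v J q B f t y e u :=
  Or.inr (Or.inr (by simp [bit, hB, hq, hu, hm, hy]))

theorem local_mem_odd {u : V} (hB : u ∈ B) (hq : u ≠ q)
    (hu : inc (E \ J) u = 1) (hy : f u + spec E v J e t u + y u = 1) :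
    LocalOK E v J q B f t y e u :=
  Or.inr (Or.inl (by simp [bit, hB, hq, hu, hy]; decide))

theorem local_base_zero (hB : q ∉ B) (h0 : inc (E \ J) q + (#B : ZMod 2) = 0)
    (h1 : inc (E \ J) q * f q + spec E v J e t q + ∑ p ∈ B, y p = 1) :
    LocalOK E v J q B f t y e q :=
  Or.inr (Or.inl (by simp [bit, hB, h0, h1]))

theorem local_base_one (hB : q ∉ B) (h0 : inc (E \ J) q + (#B : ZMod 2) = 1)
    (hm : Mono E v J e t q) (h1 : ∀ p ∈ B, y p = f q) :
    LocalOK E v J q B f t y e q :=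
  Or.inr (Or.inr ⟨by simp [bit, hB, h0], hm, fun h => absurd h hB, fun _ => h1⟩)

end

theorem coverable_of_toggle (hG : Good E v J) (hd : inc E v = 0) {a : V} (ha : s(v, a) ∈ E)
    {e : V → V} {f t t' y y' : V → ZMod 2} (hf : Solves E v J e f)
    (hta : t' a = t a + 1) (ht : ∀ u, u ≠ a → t' u = t u) {q q' : V} {B B' : Finset V}
    (hB : ∀ p ∈ B, s(q, p) ∈ J) (hB' : ∀ p ∈ B', s(q', p) ∈ J)
    (h : ∀ u, u ≠ v → LocalOK E v J q B f t y e u)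
    (h' : ∀ u, u ≠ v → LocalOK E v J q' B' f t' y' e u) : Coverable E := by
  rw [← hG.inc_compl_zero] at hd
  rcases zmod_two_cases (∑ x, bit (s(v, x) ∈ E) * (f x + t x)) with h0 | h0
  · refine coverable_of_colour hG q' B' v f t' y' e hf hB' (by simp) (fun u hu _ => h' u hu)
      (by simp) (Or.inl ⟨rfl, hd, ?_⟩)
    have : ∀ x, bit (s(v, x) ∈ E) * (f x + t' x) =
        bit (s(v, x) ∈ E) * (f x + t x) + bit (x = a) * bit (s(v, x) ∈ E) := by
      intro x
      by_cases hx : x = a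
      · rw [hx, hta, bit_pos (rfl : a = a)]; ring
      · rw [ht x hx, bit_neg hx]; ring
    simp only [this, sum_add_distrib, h0, sum_bit_eq, bit_pos ha, zero_add]
  · exact coverable_of_colour hG q B v f t y e hf hB (by simp) (fun u hu _ => h u hu)
      (by simp) (Or.inl ⟨rfl, hd, h0⟩)

theorem exists_shift {k f : V → ZMod 2} {e : V → V} (hf : Solves E v J e f)
    (hk : Inv E v J k) (i : ZMod 2) {u : V} (hu : k u = 1) :
    ∃ f', Solves E v J e f' ∧ f' u = i ∧ ∀ x, k x = 0 → f' x = f x := by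
  refine ⟨_, hf.shift (k := fun x => (i + f u) * k x) fun u w h => ?_, ?_, fun x hx => ?_⟩
  · simp only [hk u w h]
  · simp only [hu]; grind
  · simp only [hx]; ring

theorem exists_shift_ind {f : V → ZMod 2} {e : V → V} (hf : Solves E v J e f) (u : V)
    (i : ZMod 2) :
    ∃ f', Solves E v J e f' ∧ f' u = i ∧ ∀ x, ¬Reach E v J u x → f' x = f x := by
  obtain ⟨f', h1, h2, h3⟩ := exists_shift hf (ind_inv u) i (ind_self u)
  exact ⟨f', h1, h2, fun x hx => h3 x (bit_neg hx)⟩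

theorem Good.toggle_std (hG : Good E v J) {a : V} (ha : s(v, a) ∈ E) {e : V → V}
    {t : V → ZMod 2} (he : e a = a) (ht : t a = inc (E \ J) a + 1) : Std E v J e t a := by
  rcases zmod_two_cases (inc (E \ J) a) with h | h
  · refine Or.inr (Or.inl ⟨h, ?_⟩)
    rw [hG.spec_self he, bit_pos ha, ht, h]; rfl
  · exact Or.inr (Or.inr ⟨h, hG.mono_self he (by rw [ht, h]; rfl)⟩)

theorem Good.toggle_local (hG : Good E v J) {a q : V} {B : Finset V} (ha : s(v, a) ∈ E)
    (haB : a ∈ B) (haq : a ≠ q) {e : V → V} {f t y : V → ZMod 2} (he : e a = a)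
    (ht : t a = inc (E \ J) a) (hy : y a = f a) : LocalOK E v J q B f t y e a := by
  rcases zmod_two_cases (inc (E \ J) a) with h | h
  · exact local_mem_even haB haq h (hG.mono_self he (by rw [ht, h])) hy
  · refine local_mem_odd haB haq h ?_
    rw [hG.spec_self he, bit_pos ha, ht, h, hy]
    grind

theorem Good.even_simple (hG : Good E v J) (hd : inc E v = 0) {a q : V} (ha : s(v, a) ∈ E)
    (haq : s(q, a) ∈ J) (hq : inc (E \ J) q = 1 ∨ ∀ w, s(q, w) ∉ E \ J) : Coverable E := by
  have hne := (hG.ne_of_mem haq).2.2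
  obtain ⟨e, t, hM, hS⟩ := hG.exists_pattern {a, q} id
    (fun u => if u = a then inc (E \ J) a + 1 else 0)
  obtain ⟨hea, hta⟩ := hM a (by simp)
  obtain ⟨heq, htq⟩ := hM q (by simp)
  simp only [id, if_true, hne, if_false] at hea hta heq htq
  obtain ⟨f₀, hf₀⟩ := hG.solve e
  obtain ⟨f, hf, hfq, hfa⟩ := exists_shift_ind hf₀ q (f₀ a + inc (E \ J) q)
  rw [← hfa a (hG.not_reach haq)] at hfq
  have hmq := hG.mono_self (t := t) heq htq
  have hq0 : (∀ w, s(q, w) ∉ E \ J) → inc (E \ J) q = 0 := fun h => by simp [inc, h]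
  refine coverable_of_toggle hG hd ha hf (y := f) (y' := f) (t := t)
    (t' := Function.update t a (t a + 1)) (q := v) (q' := q) (B := ∅) (B' := {a})
    (by simp) (fun u hu => by simp [hu]) (by simp) (by simpa using haq) ?_ ?_
  · intro u hu
    refine Std.local_empty ?_ hu
    by_cases h1 : u = a
    · exact h1 ▸ hG.toggle_std ha hea hta
    · by_cases h2 : u = q
      · rw [h2]
        rcases hq with h | h
        · exact Or.inr (Or.inr ⟨h, hmq⟩)
        · exact Or.inl h
      · exact hS u (by simp [h1, h2]) hu
  · intro u hu
    by_cases h1 : u = a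
    · rw [h1]
      exact hG.toggle_local ha (by simp) hne.symm hea (by simp [hta]; grind) rfl
    · by_cases h2 : u = q
      · rw [h2]
        have hmq' := hG.mono_self (t := Function.update t a (t a + 1)) heq (by simp [hne, htq])
        rcases hq with h | h
        · refine local_base_zero (by simp [hne]) (by simp [h]; rfl) ?_
          rw [hmq'.spec, h, sum_singleton, hfq, h]; grind
        · refine local_base_one (by simp [hne]) (by simp [hq0 h]) hmq' ?_
          simp [hfq, hq0 h]
      · refine Std.localOK ?_ (by simpa using h1) h2
        exact (hS u (by simp [h1, h2]) hu).congr rfl (by simp [h1])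

theorem Good.even_pair (hG : Good E v J) (hd : inc E v = 0) {a p q : V} (ha : s(v, a) ∈ E)
    (haq : s(q, a) ∈ J) (hpq : s(q, p) ∈ J) (hpa : p ≠ a) (hq : inc (E \ J) q = 0)
    (hp : inc (E \ J) p = 0) {e : V → V} {f t : V → ZMod 2} (hf : Solves E v J e f)
    (hea : e a = a) (hta : t a = inc (E \ J) a + 1) (hep : e p = p) (htp : t p = 0)
    (heq : e q = q) (htq : t q = 0)
    (hS : ∀ u, u ∉ ({a, p, q} : Finset V) → u ≠ v → Std E v J e t u)
    (hfpa : f p ≠ f a) : Coverable E := by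
  have hne := (hG.ne_of_mem haq).2.2
  have hne' := (hG.ne_of_mem hpq).2.2
  obtain ⟨f', hf', hfq, h1⟩ := exists_shift_ind hf q (f p)
  have h1a := h1 a (hG.not_reach haq)
  have h1p := h1 p (hG.not_reach hpq)
  rw [← h1p] at hfq
  rw [← h1p, ← h1a] at hfpa
  clear h1 h1a h1p hf f
  refine coverable_of_toggle hG hd ha hf' (y := f') (y' := f') (t := t)
    (t' := Function.update t a (t a + 1)) (q := q) (q' := q) (B := {p}) (B' := {p, a})
    (by simp) (fun u hu => by simp [hu]) (by simpa using hpq) (by simp [hpq, haq]) ?_ ?_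
  · intro u hu
    by_cases h1 : u = a
    · rw [h1]
      exact (hG.toggle_std ha hea hta).localOK (by simpa using hpa.symm) hne.symm
    by_cases h2 : u = q
    · rw [h2]
      exact local_base_one (by simpa using hne') (by simp [hq]) (hG.mono_self heq htq)
        (by simp [hfq])
    by_cases h3 : u = p
    · rw [h3]
      exact local_mem_even (by simp) hne'.symm hp (hG.mono_self hep htp) rfl
    exact (hS u (by simp [h1, h2, h3]) hu).localOK (by simp [h3]) h2
  · intro u hu
    by_cases h1 : u = a
    · rw [h1]
      exact hG.toggle_local ha (by simp) hne.symm hea (by simp [hta]; grind) rfl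
    by_cases h2 : u = q
    · rw [h2]
      refine local_base_zero (by simp [hne, hne']) (by rw [hq, card_pair hpa]; rfl) ?_
      rw [sum_pair hpa, hq, (hG.mono_self heq (by simp [htq, hne])).spec, zmod_two_ne hfpa]
      grind
    by_cases h3 : u = p
    · rw [h3]
      exact local_mem_even (by simp) hne'.symm hp (hG.mono_self hep (by simp [htp, hpa])) rfl
    · exact ((hS u (by simp [h1, h2, h3]) hu).congr rfl (by simp [h1])).localOK
        (by simp [h1, h3]) h2

theorem Good.even_odd (hG : Good E v J) (hd : inc E v = 0) {a p q : V} (ha : s(v, a) ∈ E)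
    (haq : s(q, a) ∈ J) (hpq : s(q, p) ∈ J) (hpa : p ≠ a) (hq : inc (E \ J) q = 0)
    (hp : inc (E \ J) p = 1) (hqe : ∃ w, s(q, w) ∈ E \ J) : Coverable E := by
  have hne := (hG.ne_of_mem haq).2.2
  have hne' := (hG.ne_of_mem hpq).2.2
  have hqv := (hG.ne_of_mem haq).1
  obtain ⟨e, t, hM, hS⟩ := hG.exists_pattern {a, p} id
    (fun u => if u = a then inc (E \ J) a + 1 else 0)
  obtain ⟨hea, hta⟩ := hM a (by simp)
  obtain ⟨hep, htp⟩ := hM p (by simp)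
  simp only [id, if_true, hpa, if_false] at hea hta hep htp
  obtain ⟨f, hf⟩ := hG.solve e
  have hStd : ∀ u, u ≠ v → Std E v J e t u := by
    intro u hu
    by_cases h1 : u = a
    · exact h1 ▸ hG.toggle_std ha hea hta
    by_cases h2 : u = p
    · exact h2 ▸ Or.inr (Or.inr ⟨hp, hG.mono_self hep htp⟩)
    exact hS u (by simp [h1, h2]) hu
  by_cases hfa : f p + 1 = f a
  · refine coverable_of_toggle hG hd ha hf (y := f) (y' := fun u => if u = p then f p + 1 else f u)
      (t := t) (t' := Function.update t a (t a + 1)) (q := v) (q' := q) (B := ∅) (B' := {p, a})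
      (by simp) (fun u hu => by simp [hu]) (by simp) (by simp [hpq, haq])
      (fun u hu => (hStd u hu).local_empty hu) ?_
    intro u hu
    by_cases h1 : u = a
    · rw [h1]
      exact hG.toggle_local ha (by simp) hne.symm hea (by simp [hta]; grind) (by simp [hpa.symm])
    by_cases h2 : u = q
    · rw [h2]
      refine local_base_zero (by simp [hne, hne']) (by rw [hq, card_pair hpa]; rfl) ?_
      rw [sum_pair hpa]
      have : Std E v J e (Function.update t a (t a + 1)) q :=
        (hStd q hqv).congr rfl (by simp [hne])
      rcases this with h | ⟨-, h⟩ | ⟨h, -⟩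
      · obtain ⟨w, hw⟩ := hqe
        exact absurd hw (h w)
      · simp only [if_true, hpa.symm, if_false, h, hfa, hq]; grind
      · rw [hq] at h; exact absurd h (by decide)
    by_cases h3 : u = p
    · rw [h3]
      refine local_mem_odd (by simp) hne'.symm hp ?_
      rw [(hG.mono_self hep (by simp [htp, hpa])).spec]
      simp only [if_true]; grind
    exact ((hStd u hu).congr rfl (by simp [h1])).localOK (by simp [h1, h3]) h2
  · obtain ⟨f₂, hf₂⟩ := hG.solve (Function.update e q q)
    obtain ⟨f₃, hf₃, -, h3⟩ := hf.glue hf₂ q (fun u hu => by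
      have : u ≠ q := fun h => hu (h ▸ Reach.rfl' _)
      simp [this])
    obtain ⟨f', hf', hfq, h1⟩ := exists_shift_ind hf₃ q (f p + 1)
    have h1a := (h1 a (hG.not_reach haq)).trans (h3 a (hG.not_reach haq))
    have h1p := (h1 p (hG.not_reach hpq)).trans (h3 p (hG.not_reach hpq))
    rw [← h1p] at hfq
    rw [← h1p, ← h1a] at hfa
    clear h1 h1a h1p hf h3 hf₃ f₃ hf₂ f₂ f
    have heq : Function.update e q q q = q := by simp
    have hep' : Function.update e q q p = p := by simp [hep, hne'.symm]
    have hea' : Function.update e q q a = a := by simp [hea, hne.symm]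
    refine coverable_of_toggle hG hd ha hf' (y := fun u => if u = p then f' p + 1 else f' u)
      (y' := fun u => if u = p then f' p + 1 else f' u) (t := Function.update t q 0)
      (t' := Function.update (Function.update t q 0) a (t a + 1)) (q := q) (q' := q)
      (B := {p}) (B' := {p, a}) (by simp [hne.symm]) (fun u hu => by simp [hu])
      (by simpa using hpq) (by simp [hpq, haq]) ?_ ?_
    · intro u hu
      by_cases h1 : u = a
      · rw [h1]
        exact (hG.toggle_std ha hea' (by simp [hta, hne.symm])).localOK (by simpa using hpa.symm)
          hne.symm
      by_cases h2 : u = q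
      · rw [h2]
        exact local_base_one (by simpa using hne') (by simp [hq])
          (hG.mono_self heq (by simp)) (by simp [hfq])
      by_cases h3 : u = p
      · rw [h3]
        refine local_mem_odd (by simp) hne'.symm hp ?_
        rw [(hG.mono_self hep' (by simp [htp, hne'.symm])).spec]
        simp only [if_true]; grind
      exact ((hStd u hu).congr (by simp [h2]) (by simp [h2])).localOK (by simp [h3]) h2
    · intro u hu
      by_cases h1 : u = a
      · rw [h1]
        exact hG.toggle_local ha (by simp) hne.symm hea' (by simp [hta]; grind)
          (by simp [hpa.symm])
      by_cases h2 : u = q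
      · rw [h2]
        refine local_base_zero (by simp [hne, hne']) (by rw [hq, card_pair hpa]; rfl) ?_
        rw [sum_pair hpa, hq, (hG.mono_self heq (by simp [hne])).spec]
        simp only [if_true, hpa.symm, if_false]
        rw [zmod_two_ne hfa]
        grind
      by_cases h3 : u = p
      · rw [h3]
        refine local_mem_odd (by simp) hne'.symm hp ?_
        rw [(hG.mono_self hep' (by simp [htp, hpa, hne'.symm])).spec]
        simp only [if_true]; grind
      · exact ((hStd u hu).congr (by simp [h2]) (by simp [h1, h2])).localOK
          (by simp [h1, h3]) h2

theorem Good.even_unreached (hG : Good E v J) (hd : inc E v = 0) {a p q : V}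
    (ha : s(v, a) ∈ E) (haq : s(q, a) ∈ J) (hpq : s(q, p) ∈ J) (hpa : p ≠ a)
    (hq : inc (E \ J) q = 0) (hp : inc (E \ J) p = 0) (hr : ¬Reach E v J a p) :
    Coverable E := by
  have hne := (hG.ne_of_mem haq).2.2
  obtain ⟨e, t, hM, hS⟩ := hG.exists_pattern {a, p, q} id
    (fun u => if u = a then inc (E \ J) a + 1 else 0)
  obtain ⟨hea, hta⟩ := hM a (by simp)
  obtain ⟨hep, htp⟩ := hM p (by simp)
  obtain ⟨heq, htq⟩ := hM q (by simp)
  simp only [id, if_true, hpa, hne, if_false] at hea hta hep htp heq htq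
  obtain ⟨f₀, hf₀⟩ := hG.solve e
  obtain ⟨f, hf, hfa, h1⟩ := exists_shift_ind hf₀ a (f₀ p + 1)
  rw [← h1 p hr] at hfa
  exact hG.even_pair hd ha haq hpq hpa hq hp hf hea hta hep htp heq htq hS
    (by rw [hfa]; simp)

theorem Good.even_path (hG : Good E v J) (hd : inc E v = 0) {a p q w : V}
    (ha : s(v, a) ∈ E) (haq : s(q, a) ∈ J) (hpq : s(q, p) ∈ J) (hpa : p ≠ a)
    (hq : inc (E \ J) q = 0) (hp : inc (E \ J) p = 0) (hw : inc (E \ J) w = 0)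
    (haw : Fadj E v J a w) (hwp : Fadj E v J w p) : Coverable E := by
  have hne := (hG.ne_of_mem haq).2.2
  have hwa := haw.ne hG
  have hwp' := hwp.ne hG
  have hwq : w ≠ q := by
    rintro rfl
    exact (mem_sdiff.1 hwp.1).2 hpq
  obtain ⟨e, t, hM, hS⟩ := hG.exists_pattern {a, p, q, w} (fun u => if u = w then a else u)
    (fun u => if u = a then inc (E \ J) a + 1 else 0)
  obtain ⟨hea, hta⟩ := hM a (by simp)
  obtain ⟨hep, htp⟩ := hM p (by simp)
  obtain ⟨heq, htq⟩ := hM q (by simp)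
  obtain ⟨hew, htw⟩ := hM w (by simp)
  simp only [if_true, hpa, hwa, hwp'.symm, if_false] at hea hta hep htp
  simp only [if_true, hne, hwa.symm, hwq.symm, if_false] at heq htq hew htw
  obtain ⟨f, hf⟩ := hG.solve e
  refine hG.even_pair hd ha haq hpq hpa hq hp hf hea hta hep htp heq htq (fun u h1 hu => ?_) ?_
  · by_cases h : u = w
    · rw [h]
      refine Or.inr (Or.inl ⟨hw, ?_⟩)
      rw [spec, hew, bit_pos haw.symm, htw]; ring
    · exact hS u (by simp_all) hu
  · have h1 := hf a w haw
    have h2 := hf w p hwp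
    rw [hea, hew, bit_neg hwa, bit_pos rfl] at h1
    rw [hew, hep, bit_neg hpa.symm, bit_neg hwp'.symm] at h2
    intro h
    have : (1 : ZMod 2) = 0 := by grind
    exact absurd this (by decide)

theorem Good.near (hG : Good E v J) {a p p' w : V} (hne : p ≠ p')
    (hw : Fadj E v J p w) (hw' : Fadj E v J w p')
    (h : Fadj E v J a p ∨ ∃ x, Fadj E v J a x ∧ Fadj E v J x p)
    (h' : Fadj E v J a p' ∨ ∃ x, Fadj E v J a x ∧ Fadj E v J x p') :
    a = w ∨ Fadj E v J a w := by
  by_contra! hc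
  obtain ⟨hc1, hc2⟩ := hc
  obtain ⟨g, hg⟩ := hG.potential (fun _ _ => 1) (fun _ _ => rfl)
  obtain ⟨k, -, -, hk⟩ := hG.jump hw
  have e1 := hk p w hw
  have e2 := hk w p' hw'
  have g1 := hg p w hw
  have g2 := hg w p' hw'
  have n1 := hw.ne hG
  have n2 := hw'.ne hG
  rw [bit_pos rfl] at e1
  rw [bit_neg (by rw [Sym2.eq_iff]; grind)] at e2
  have key : ∀ x, Fadj E v J a x → k a = k x := by
    intro x hx
    have := hk a x hx
    rw [bit_neg (by rw [Sym2.eq_iff]; grind)] at this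
    grind
  have key' : ∀ x y, Fadj E v J a x → Fadj E v J x y → y = p ∨ y = p' → k x = k y := by
    intro x y hx hxy hy
    have := hk x y hxy
    rw [bit_neg (by rw [Sym2.eq_iff]; have := hx.ne hG; have := hxy.ne hG; grind)] at this
    grind
  rcases h with h | ⟨x, hx, hxp⟩
  · rcases h' with h' | ⟨x', hx', hxp'⟩
    · have := key _ h
      have := key _ h'
      grind
    · have := hg _ _ h
      have := hg _ _ hx'
      have := hg _ _ hxp'
      grind
  · rcases h' with h' | ⟨x', hx', hxp'⟩
    · have := hg _ _ h'
      have := hg _ _ hx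
      have := hg _ _ hxp
      grind
    · have := key _ hx
      have := key _ hx'
      have := key' _ _ hx hxp (Or.inl rfl)
      have := key' _ _ hx' hxp' (Or.inr rfl)
      grind

theorem Good.even_parity (hG : Good E v J) (hd : inc E v = 0) {a : V}
    (h : ∑ x, bit (s(v, x) ∈ E) * ind E v J a x = 1) : Coverable E := by
  rw [← hG.inc_compl_zero] at hd
  obtain ⟨e, t, -, hS⟩ := hG.exists_pattern ∅ id 0
  obtain ⟨f, hf⟩ := hG.solve e
  have key : ∀ f, Solves E v J e f → ∑ x, bit (s(v, x) ∈ E) * (f x + t x) = 1 →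
      Coverable E := fun f hf h =>
    coverable_of_colour hG v ∅ v f t f e hf (by simp) (by simp)
      (fun u hu _ => (hS u (by simp) hu).local_empty hu) (by simp) (Or.inl ⟨rfl, hd, h⟩)
  rcases zmod_two_cases (∑ x, bit (s(v, x) ∈ E) * (f x + t x)) with h0 | h0
  · refine key _ (hf.shift (ind_inv a)) ?_
    simp only [add_right_comm _ (ind E v J a _), mul_add (bit _) (_ + _) (ind E v J a _),
      sum_add_distrib, h0, h, zero_add]
  · exact key f hf h0

theorem Good.exists_reach_of_even {k : V → ZMod 2} {a : V} (hk : k a = 1) (ha : s(v, a) ∈ E)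
    (h : ∑ x, bit (s(v, x) ∈ E) * k x = 0) : ∃ c, c ≠ a ∧ s(v, c) ∈ E ∧ k c = 1 := by
  by_contra! hc
  rw [sum_eq_single a] at h
  · rw [hk, bit_pos ha] at h
    exact absurd h (by decide)
  · intro c _ hca
    by_cases hN : s(v, c) ∈ E
    · rw [(zmod_two_cases _).resolve_right (hc c hca hN), mul_zero]
    · rw [bit_neg hN, zero_mul]
  · simp

theorem coverable_even (n : ℕ) {a : V} (ha : s(v, a) ∈ E) (hd : inc E v = 0) :
    ∀ J, Good E v J → #{x | ind E v J a x = 1} ≤ n → Coverable E := by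
  induction n with
  | zero =>
    intro J hG h
    have h0 := card_eq_zero.1 (Nat.le_zero.1 h)
    exact absurd (ind_self a) (filter_eq_empty_iff.1 h0 (mem_univ a))
  | succ n ih =>
    intro J hG hn
    rcases zmod_two_cases (∑ x, bit (s(v, x) ∈ E) * ind E v J a x) with h0 | h0
    swap
    · exact hG.even_parity hd h0
    obtain ⟨c, hca, hc, hrc⟩ := Good.exists_reach_of_even (ind_self a) ha h0
    rw [ind, bit_eq_one] at hrc
    have hav : a ≠ v := fun h => hG.loopless v (h ▸ ha)
    obtain ⟨q, hq⟩ := exists_of_inc (hG.one a hav)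
    rw [Sym2.eq_swap] at hq
    by_cases hs : inc (E \ J) q = 1 ∨ ∀ w, s(q, w) ∉ E \ J
    · exact hG.even_simple hd ha hq hs
    push Not at hs
    obtain ⟨hq1, hqe⟩ := hs
    have hq0 := (zmod_two_cases _).resolve_right hq1
    have hqv := (hG.ne_of_mem hq).1
    obtain ⟨p, hpa, hp⟩ := hG.exists_other hq hc hca hrc.symm
    obtain ⟨p', hpa', hpp, hp'⟩ := exists_third (hG.one q hqv) hq hp hpa.symm
    have key : ∀ x, x ≠ a → s(q, x) ∈ J → Coverable E ∨ (inc (E \ J) x = 0 ∧ Reach E v J a x) := by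
      intro x hxa hx
      rcases zmod_two_cases (inc (E \ J) x) with h | h
      · by_cases hr : Reach E v J a x
        · exact Or.inr ⟨h, hr⟩
        · exact Or.inl (hG.even_unreached hd ha hq hx hxa hq0 h hr)
      · exact Or.inl (hG.even_odd hd ha hq hx hxa hq0 h hqe)
    rcases key p hpa hp with h | ⟨hp0, hrp⟩
    · exact h
    rcases key p' hpa' hp' with h | ⟨hp0', hrp'⟩
    · exact h
    have s1 := hG.short_path hq hp hpa.symm hrp
    have s2 := hG.short_path hq hp' hpa'.symm hrp'
    rcases hG.short_path hp hp' hpp.symm (hrp.symm.trans hrp') with hF | ⟨w, hw, hw'⟩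
    · rcases s1 with s1 | ⟨x, hx, hxp⟩
      · exact hG.even_path hd ha hq hp' hpa' hq0 hp0' hp0 s1 hF
      rcases s2 with s2 | ⟨y, hy, hyp⟩
      · exact hG.even_path hd ha hq hp hpa hq0 hp0 hp0' s2 hF.symm
      obtain ⟨g, hg⟩ := hG.potential (fun _ _ => 1) (fun _ _ => rfl)
      have := hg _ _ hF
      have := hg _ _ hx
      have := hg _ _ hxp
      have := hg _ _ hy
      have := hg _ _ hyp
      grind
    · have hnear := hG.near hpp.symm hw hw' s1 s2
      obtain ⟨g₁, h10, h11, h1⟩ := hG.jump hw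
      obtain ⟨g₂, h20, h21, h2⟩ := hG.jump hw'.symm
      have hG' := hG.swap hp hp' hpp.symm hw hw'
      have hinv := Inv.swap (z := q) hpp.symm hw hw' (ind_inv a)
        (bit_neg fun h => hG.not_reach (by rw [Sym2.eq_swap]; exact hq) h) h10 h11 h20 h21 h1 h2
      set k := ind E v J a with hk
      have ha1 : k a * (1 + g₁ a + g₂ a) = 1 := by
        have hka : k a = 1 := ind_self a
        rcases hnear with rfl | h
        · rw [hka]; grind
        · have e1 := h1 a w h
          have e2 := h2 a w h
          rw [bit_neg (by rw [Sym2.congr_left]; exact hpa.symm)] at e1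
          rw [bit_neg (by rw [Sym2.congr_left]; exact hpa'.symm)] at e2
          rw [hka]; grind
      refine ih _ hG' ?_
      have : #{x | ind E v (OddCover.swap J q w p p') a x = 1} < #{x | k x = 1} := by
        refine card_lt_card ((ssubset_iff_of_subset ?_).2 ⟨p, ?_, ?_⟩)
        · intro x hx
          rw [mem_filter] at hx ⊢
          refine ⟨mem_univ x, ?_⟩
          have h3 := hinv.reach (bit_eq_one.1 hx.2)
          simp only [ha1] at h3
          by_contra h4
          rw [(zmod_two_cases _).resolve_right h4, zero_mul] at h3
          exact absurd h3 (by decide)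
        · rw [mem_filter]
          exact ⟨mem_univ p, bit_pos hrp⟩
        · rw [mem_filter]
          rintro ⟨-, h3⟩
          have h3 := hinv.reach (bit_eq_one.1 h3)
          simp only [ha1, h10] at h3
          have e2 := h2 p w hw
          rw [bit_neg (by rw [Sym2.congr_left]; exact hpp.symm)] at e2
          grind
      omega

/-- The sum of `g` over the neighbours of `v`. -/
noncomputable def nsum (E : Finset (Sym2 V)) (v : V) (g : V → ZMod 2) : ZMod 2 :=
  ∑ x, bit (s(v, x) ∈ E) * g x

theorem nsum_add (g h : V → ZMod 2) :
    nsum E v (fun x => g x + h x) = nsum E v g + nsum E v h := by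
  simp only [nsum, mul_add, sum_add_distrib]

theorem nsum_mul (i : ZMod 2) (h : V → ZMod 2) :
    nsum E v (fun x => i * h x) = i * nsum E v h := by
  simp only [nsum, mul_left_comm _ i, ← mul_sum]

theorem nsum_const (i : ZMod 2) : nsum E v (fun _ => i) = i * inc E v := by
  rw [nsum, ← sum_mul, ← inc_eq_bit, mul_comm]

theorem nsum_congr {g h : V → ZMod 2} (H : ∀ x, s(v, x) ∈ E → g x = h x) :
    nsum E v g = nsum E v h := by
  refine sum_congr rfl fun x _ => ?_
  by_cases hx : s(v, x) ∈ E
  · rw [H x hx]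
  · rw [bit_neg hx, zero_mul, zero_mul]

theorem exists_of_nsum {g : V → ZMod 2} (h : nsum E v g = 1) : ∃ x, s(v, x) ∈ E ∧ g x = 1 := by
  by_contra! hc
  have := nsum_congr (E := E) (v := v) (g := g) (h := fun _ => 0)
    (fun x hx => (zmod_two_cases _).resolve_right (hc x hx))
  rw [this, nsum_const, zero_mul] at h
  exact absurd h (by decide)

theorem nsum_single {g : V → ZMod 2} {a : V} (ha : s(v, a) ∈ E)
    (h : ∀ x, s(v, x) ∈ E → x ≠ a → g x = 0) : nsum E v g = g a := by
  rw [nsum, sum_eq_single a]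
  · rw [bit_pos ha, one_mul]
  · intro x _ hx
    by_cases hE : s(v, x) ∈ E
    · rw [h x hE hx, mul_zero]
    · rw [bit_neg hE, zero_mul]
  · simp

theorem exists_adjust {k f : V → ZMod 2} {e : V → V} (hf : Solves E v J e f)
    (hk : Inv E v J k) (hs : nsum E v k = 1) (t : V → ZMod 2) (g : V → ZMod 2) (b : V)
    (hb : k b = 0) :
    ∃ f', Solves E v J e f' ∧ nsum E v (fun x => f' x + t x) = f' b + g b ∧
      ∀ x, k x = 0 → f' x = f x := by
  set i := nsum E v (fun x => f x + t x) + f b + g b with hi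
  refine ⟨_, hf.shift (k := fun x => i * k x) fun u w h => ?_, ?_, fun x hx => ?_⟩
  · simp only [hk u w h]
  · simp only [add_right_comm _ (i * k _), hb]
    rw [nsum_add, nsum_mul, hs]
    grind
  · simp only [hx]; ring

theorem Good.odd_single (hG : Good E v J) (hd : inc E v = 1) {b : V} (hb : s(v, b) ∈ E)
    (hb1 : inc (E \ J) b = 1) {e : V → V} {f t : V → ZMod 2} (hf : Solves E v J e f)
    (hS : ∀ u, u ≠ v → Std E v J e t u)
    (hX : nsum E v (fun x => f x + t x) = f b + t b) : Coverable E := by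
  rw [← hG.inc_compl_zero] at hd
  have hbv : b ≠ v := fun h => hG.loopless v (by rwa [h] at hb)
  have hm : Mono E v J e t b := by
    rcases hS b hbv with h | ⟨h, -⟩ | ⟨-, h⟩
    · simp [inc, h] at hb1
    · rw [hb1] at h; exact absurd h (by decide)
    · exact h
  refine coverable_of_colour hG v ∅ b f t f e hf (by simp) (fun _ => hb)
    (fun u hu _ => (hS u hu).local_empty hu) (fun _ => ?_) (Or.inr (Or.inr ⟨hbv, hd, hX⟩))
  simp [hb1, hm.spec, hm.2 hb, bit]

/-- Configurations with a doubled edge `v b`, where `b` has even degree outside `J`. -/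
theorem Good.odd_even (hG : Good E v J) (hd : inc E v = 1) {b q : V} (hb : s(v, b) ∈ E)
    (hb0 : inc (E \ J) b = 0) {B : Finset V} (hB : ∀ p ∈ B, s(q, p) ∈ J) (hbB : b ∈ B)
    {e : V → V} {f t y : V → ZMod 2} (hf : Solves E v J e f) (hy : y b = f b)
    (heb : e b = b) (hq : LocalOK E v J q B f t y e q)
    (hBL : ∀ p ∈ B, p ≠ b → LocalOK E v J q B f t y e p)
    (hS : ∀ u, u ∉ B → u ≠ q → u ≠ v → Std E v J e t u)
    (hX : nsum E v (fun x => f x + t x) = f b + t b) : Coverable E := by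
  rw [← hG.inc_compl_zero] at hd
  have hbv : b ≠ v := fun h => hG.loopless v (by rwa [h] at hb)
  have hbq : b ≠ q := (hG.ne_of_mem (hB b hbB)).2.2.symm
  refine coverable_of_colour hG q B b f t y e hf hB (fun _ => hb)
    (fun u hu hub => ?_) (fun _ => ?_) (Or.inr (Or.inr ⟨hbv, hd, hX⟩))
  · by_cases h1 : u = q
    · rwa [h1]
    by_cases h2 : u ∈ B
    · exact hBL u h2 hub
    exact (hS u h2 h1 hu).localOK h2 h1
  · rw [hG.spec_self heb, bit_pos hb, bit_pos hbB, bit_neg hbq, hb0, hy]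
    exact ⟨by ring, by ring⟩

theorem Good.odd_pair (hG : Good E v J) (hd : inc E v = 1) {b q : V} (hb : s(v, b) ∈ E)
    (hb0 : inc (E \ J) b = 0) (hbq : s(q, b) ∈ J)
    {e : V → V} {f t : V → ZMod 2} (hf : Solves E v J e f)
    (heb : e b = b) (heq : e q = q) (htq : s(v, q) ∈ E → t q = 0)
    (hS : ∀ u, u ≠ b → u ≠ q → u ≠ v → Std E v J e t u)
    (hfq : f q = f b + inc (E \ J) q)
    (hX : nsum E v (fun x => f x + t x) = f b + t b) : Coverable E := by
  have hne := (hG.ne_of_mem hbq).2.2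
  have hm : Mono E v J e t q := ⟨by rw [heq]; exact hG.not_fadj_self q, htq⟩
  refine hG.odd_even hd hb hb0 (B := {b}) (by simpa using hbq) (by simp) hf (y := f) rfl heb
    ?_ (by simp) (by simpa using hS) hX
  rcases zmod_two_cases (inc (E \ J) q) with h | h
  · exact local_base_one (by simpa using hne) (by simp [h]) hm (by simp [hfq, h])
  · refine local_base_zero (by simpa using hne) (by simp [h]; rfl) ?_
    rw [hm.spec, h, sum_singleton, hfq, h]; grind

theorem Good.odd_reached (hG : Good E v J) (hd : inc E v = 1)
    (h : ∀ x y, s(v, x) ∈ E → s(v, y) ∈ E → Reach E v J x y) : Coverable E := by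
  obtain ⟨e, t, hM, hS⟩ := hG.exists_pattern {x | s(v, x) ∈ E} id (fun x => inc (E \ J) x + 1)
  have hM : ∀ x, s(v, x) ∈ E → e x = x ∧ t x = inc (E \ J) x + 1 := fun x hx =>
    hM x (by simpa using hx)
  have hS : ∀ u, u ≠ v → Std E v J e t u := by
    intro u hu
    by_cases hN : s(v, u) ∈ E
    · exact hG.toggle_std hN (hM u hN).1 (hM u hN).2
    · exact hS u (by simpa using hN) hu
  obtain ⟨f, hf⟩ := hG.solve e
  obtain ⟨b, hb, hX⟩ : ∃ b, s(v, b) ∈ E ∧ nsum E v (fun x => f x + t x) = f b + t b := by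
    by_contra! hc
    have := nsum_congr (E := E) (v := v) (g := fun x => f x + t x)
      (h := fun _ => nsum E v (fun x => f x + t x) + 1)
      (fun x hx => zmod_two_ne (hc x hx).symm)
    rw [nsum_const, hd] at this
    simp at this
  rcases zmod_two_cases (inc (E \ J) b) with hb0 | hb1
  · have hbv : b ≠ v := fun h => hG.loopless v (by rwa [h] at hb)
    obtain ⟨q, hq⟩ := exists_of_inc (hG.one b hbv)
    rw [Sym2.eq_swap] at hq
    have hne := (hG.ne_of_mem hq).2.2
    have hqN : ∀ x, s(v, x) ∈ E → ¬Reach E v J q x := fun x hx h' =>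
      hG.not_reach hq (h'.trans (h x b hx hb))
    obtain ⟨f₂, hf₂⟩ := hG.solve (Function.update e q q)
    obtain ⟨f₃, hf₃, -, h3⟩ := hf.glue hf₂ q (fun u hu => by
      have : u ≠ q := fun h => hu (h ▸ Reach.rfl' _)
      simp [this])
    obtain ⟨f', hf', hfq, h1⟩ := exists_shift_ind hf₃ q (f b + inc (E \ J) q)
    have h4 : ∀ x, s(v, x) ∈ E → f' x = f x := fun x hx =>
      (h1 x (hqN x hx)).trans (h3 x (hqN x hx))
    refine hG.odd_pair hd hb hb0 hq hf' (t := t) (by simp [hne.symm, (hM b hb).1]) (by simp)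
      (fun h => absurd (Reach.rfl' _) (hqN q h))
      (fun u _ h2 h3 => (hS u h3).congr (by simp [h2]) rfl) (by rw [hfq, h4 b hb]) ?_
    rw [h4 b hb, ← hX]
    exact nsum_congr fun x hx => by rw [h4 x hx]
  · exact hG.odd_single hd hb hb1 hf hS hX

variable {k : V → ZMod 2}

theorem Good.odd_of_odd (hG : Good E v J) (hd : inc E v = 1) (hk : Inv E v J k)
    (hs : nsum E v k = 1) {b : V} (hb : s(v, b) ∈ E) (hkb : k b = 0)
    (hb1 : inc (E \ J) b = 1) : Coverable E := by
  obtain ⟨e, t, -, hS⟩ := hG.exists_pattern ∅ id 0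
  obtain ⟨f, hf⟩ := hG.solve e
  obtain ⟨f', hf', hX, -⟩ := exists_adjust hf hk hs t t b hkb
  exact hG.odd_single hd hb hb1 hf' (fun u hu => hS u (by simp) hu) hX

theorem Good.odd_of_base (hG : Good E v J) (hd : inc E v = 1) (hk : Inv E v J k)
    (hs : nsum E v k = 1) {b q : V} (hb : s(v, b) ∈ E) (hkb : k b = 0)
    (hb0 : inc (E \ J) b = 0) (hq : s(q, b) ∈ J) (hkq : k q = 0) : Coverable E := by
  obtain ⟨e, t, hM, hS⟩ := hG.exists_pattern {b, q} id 0
  obtain ⟨heb, -⟩ := hM b (by simp)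
  obtain ⟨heq, htq⟩ := hM q (by simp)
  obtain ⟨f, hf⟩ := hG.solve e
  obtain ⟨f₁, hf₁, h1, h1'⟩ := exists_shift_ind hf q (f b + inc (E \ J) q)
  obtain ⟨f₂, hf₂, hX, h2⟩ := exists_adjust hf₁ hk hs t t b hkb
  refine hG.odd_pair hd hb hb0 hq hf₂ heb heq (fun _ => htq)
    (fun u h3 h4 h5 => hS u (by simp [h3, h4]) h5) ?_ hX
  rw [h2 q hkq, h2 b hkb, h1, h1' b (hG.not_reach hq)]

theorem Good.odd_alone (hG : Good E v J) (hd : inc E v = 1) (hk : Inv E v J k)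
    (hs : nsum E v k = 1) {b q : V} (hb : s(v, b) ∈ E) (hkb : k b = 0)
    (hb0 : inc (E \ J) b = 0) (hq : s(q, b) ∈ J)
    (h : ∀ c, s(v, c) ∈ E → Reach E v J b c → c = b) : Coverable E := by
  obtain ⟨e, t, hM, hS⟩ := hG.exists_pattern {b, q} id 0
  obtain ⟨heb, -⟩ := hM b (by simp)
  obtain ⟨heq, htq⟩ := hM q (by simp)
  obtain ⟨f, hf⟩ := hG.solve e
  obtain ⟨f₁, hf₁, hX, -⟩ := exists_adjust hf hk hs t t b hkb
  set i := f₁ q + inc (E \ J) q + f₁ b with hi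
  have hbq : ind E v J b q = 0 := bit_neg fun h' => hG.not_reach hq h'.symm
  have hsum : nsum E v (ind E v J b) = 1 := by
    rw [nsum_single (g := ind E v J b) hb (fun x hx hxb => bit_neg fun h' => hxb (h x hx h')),
      ind_self]
  refine hG.odd_pair hd hb hb0 hq (hf₁.shift (k := fun x => i * ind E v J b x) ?_) heb heq
    (fun _ => htq) (fun u h3 h4 h5 => hS u (by simp [h3, h4]) h5) ?_ ?_ (t := t)
  · intro u w huw
    simp only [ind_inv b u w huw]
  · simp only [hbq, ind_self]; grind
  · simp only [add_right_comm _ (i * _)]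
    rw [nsum_add, nsum_mul, hsum, hX, ind_self]

theorem Good.odd_base_even (hG : Good E v J) (hd : inc E v = 1) (hk : Inv E v J k)
    (hs : nsum E v k = 1) {b q p : V} (hb : s(v, b) ∈ E) (hkb : k b = 0)
    (hb0 : inc (E \ J) b = 0) (hq : s(q, b) ∈ J) (hq0 : inc (E \ J) q = 0)
    (hqe : ∃ w, s(q, w) ∈ E \ J) (hp : s(q, p) ∈ J) (hpb : p ≠ b) (hkp : k p = 0) :
    Coverable E := by
  have hne := (hG.ne_of_mem hq).2.2
  have hne' := (hG.ne_of_mem hp).2.2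
  have hqv := (hG.ne_of_mem hp).1
  obtain ⟨e, t, hM, hS⟩ := hG.exists_pattern {b, p} id 0
  obtain ⟨heb, -⟩ := hM b (by simp)
  obtain ⟨hep, htp⟩ := hM p (by simp)
  simp only [id, Pi.zero_apply] at heb hep htp
  obtain ⟨f, hf⟩ := hG.solve e
  have hpL : ∀ (e : V → V) (f t : V → ZMod 2), e p = p → t p = 0 → LocalOK E v J q {b, p} f t
      (fun u => if u = p then f p + inc (E \ J) p else f u) e p := by
    intro e f t hep htp
    rcases zmod_two_cases (inc (E \ J) p) with h | h
    · exact local_mem_even (by simp) hne'.symm h (hG.mono_self hep htp) (by simp [h])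
    · refine local_mem_odd (by simp) hne'.symm h ?_
      rw [(hG.mono_self hep htp).spec]
      simp only [if_true, h]; grind
  by_cases hfb : f b = f p + inc (E \ J) p
  · obtain ⟨f₁, hf₁, hX, h1⟩ := exists_adjust hf hk hs t t b hkb
    rw [← h1 b hkb, ← h1 p hkp] at hfb
    refine hG.odd_even hd hb hb0 (q := q) (B := {b, p}) (by simp [hq, hp]) (by simp) hf₁
      (y := fun u => if u = p then f₁ p + inc (E \ J) p else f₁ u) (by simp [hpb.symm]) heb ?_
      (fun x hx hxb => ?_) (fun u h2 _ h3 => hS u h2 h3) hX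
    · refine local_base_zero (by simp [hne, hne']) (by rw [hq0, card_pair hpb.symm]; rfl) ?_
      rcases hS q (by simp [hne, hne']) hqv with h | ⟨-, h⟩ | ⟨h, -⟩
      · obtain ⟨w, hw⟩ := hqe
        exact absurd hw (h w)
      · rw [sum_pair hpb.symm, hq0, h]
        simp only [hpb.symm, if_false, if_true]
        grind
      · rw [hq0] at h; exact absurd h (by decide)
    · have : x = p := by simpa [hxb] using hx
      exact this ▸ hpL e f₁ t hep htp
  · obtain ⟨f₂, hf₂⟩ := hG.solve (Function.update e q q)
    obtain ⟨f₃, hf₃, -, h3⟩ := hf.glue hf₂ q (fun u hu => by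
      have : u ≠ q := fun h => hu (h ▸ Reach.rfl' _)
      simp [this])
    rw [← h3 b (hG.not_reach hq), ← h3 p (hG.not_reach hp)] at hfb
    obtain ⟨f₁, hf₁, hX, h1⟩ := exists_adjust hf₃ hk hs (Function.update t q 0)
      (Function.update t q 0) b hkb
    rw [← h1 b hkb, ← h1 p hkp] at hfb
    refine hG.odd_even hd hb hb0 (q := q) (B := {b, p}) (by simp [hq, hp]) (by simp) hf₁
      (y := fun u => if u = p then f₁ p + inc (E \ J) p else f₁ u) (by simp [hpb.symm])
      (by simp [hne.symm, heb]) ?_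
      (fun x hx hxb => ?_) (fun u h2 h3 h4 => (hS u h2 h4).congr (by simp [h3]) (by simp [h3])) hX
    · refine local_base_zero (by simp [hne, hne']) (by rw [hq0, card_pair hpb.symm]; rfl) ?_
      rw [sum_pair hpb.symm, hq0, (hG.mono_self (by simp) (by simp)).spec]
      simp only [hpb.symm, if_false, if_true]
      rw [zmod_two_ne hfb]
      grind
    · have : x = p := by simpa [hxb] using hx
      exact this ▸ hpL _ f₁ _ (by simp [hne'.symm, hep]) (by simp [hne'.symm, htp])

theorem Good.odd_base_odd (hG : Good E v J) (hd : inc E v = 1) (hk : Inv E v J k)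
    (hs : nsum E v k = 1) {b q u : V} (hb : s(v, b) ∈ E) (hkb : k b = 0)
    (hb0 : inc (E \ J) b = 0) (hq : s(q, b) ∈ J) (hq1 : inc (E \ J) q = 1) (hkq : k q = 1)
    (hqu : Fadj E v J q u) {g : V → ZMod 2} (hgq : g q = 0)
    (hg : ∀ x y, Fadj E v J x y → g x + g y = bit (s(x, y) = s(q, u)))
    (hgs : nsum E v (fun x => k x * g x) = 0) : Coverable E := by
  have hne := (hG.ne_of_mem hq).2.2
  obtain ⟨e, t, hM, hS⟩ := hG.exists_pattern {b, q} id 0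
  obtain ⟨heb, htb⟩ := hM b (by simp)
  obtain ⟨heq, htq⟩ := hM q (by simp)
  simp only [id, Pi.zero_apply] at heb htb heq htq
  obtain ⟨f₀, hf₀⟩ := hG.solve e
  obtain ⟨f, hf, hfq, h1⟩ := exists_shift hf₀ hk (f₀ b + 1) hkq
  rw [← h1 b hkb] at hfq
  clear h1 hf₀ f₀
  by_cases hX : nsum E v (fun x => f x + t x) = f b + t b
  · exact hG.odd_pair hd hb hb0 hq hf heb heq (fun _ => htq)
      (fun u h3 h4 h5 => hS u (by simp [h3, h4]) h5) (by rw [hfq, hq1]) hX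
  have hqu' := hqu.ne hG
  have heq' : Function.update e q u q = u := by simp
  have hf' : Solves E v J (Function.update e q u) (fun x => f x + k x * (1 + g x)) := by
    have key : ∀ x y, Fadj E v J x y →
        bit (Function.update e q u x = y) + bit (Function.update e q u y = x) =
        bit (e x = y) + bit (e y = x) + bit (s(x, y) = s(q, u))
          + bit (s(x, y) = s(q, u) ∧ e u = q) * 0 := by
      intro x y hxy
      by_cases hx : x = q
      · subst hx
        have h1 : y ≠ x := (hxy.ne hG).symm
        have h2 : x ≠ y := (hxy.ne hG)
        rw [heq', heq, Function.update_of_ne h1, bit_neg h2, Sym2.congr_right,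
          show (u = y) = (y = u) from propext eq_comm]
        ring
      · by_cases hy : y = q
        · subst hy
          rw [heq', heq, Function.update_of_ne hx, bit_neg (Ne.symm hx), Sym2.eq_swap,
            Sym2.congr_right, show (u = x) = (x = u) from propext eq_comm]
          ring
        · rw [Function.update_of_ne hx, Function.update_of_ne hy, bit_neg (p := s(x, y) = s(q, u))]
          · ring
          · rw [Sym2.eq_iff]; grind
    intro x y hxy
    have e1 := key x y hxy
    have e2 := hf x y hxy
    have e3 := hg x y hxy
    have e4 := hk x y hxy
    rw [mul_zero, add_zero] at e1
    by_cases h : s(x, y) = s(q, u)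
    · have : k y = 1 := by
        rcases Sym2.eq_iff.1 h with ⟨rfl, rfl⟩ | ⟨rfl, rfl⟩
        · rw [← e4]; exact hkq
        · exact hkq
      rw [bit_pos h] at e1 e3
      simp only [e4, this]
      grind
    · rw [bit_neg h] at e1 e3
      have : g x = g y := by grind
      simp only [e4, this]
      grind
  refine hG.odd_even hd hb hb0 (q := q) (B := {b}) (by simpa using hq) (by simp) hf'
    (y := f) (by simp [hkb]) (by simp [hne.symm, heb]) ?_ (by simp) (t := t)
    (fun x h2 h3 h4 => (hS x (by simpa using ⟨by simpa using h2, h3⟩) h4).congr (by simp [h3]) rfl)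
    ?_
  · refine local_base_zero (by simpa using hne) (by simp [hq1]; rfl) ?_
    simp only [spec, heq', bit_pos hqu, htq, sum_singleton, hkq, hgq, hq1, hfq]
    grind
  · have h := zmod_two_ne hX
    rw [nsum_add] at h
    simp only [mul_add, mul_one]
    rw [nsum_add, nsum_add, nsum_add, hs, hgs, hkb]
    grind

theorem Reach.eq_of_isolated {q x : V} (h : ∀ w, ¬Fadj E v J q w) (hx : Reach E v J q x) :
    x = q := by
  rcases Relation.ReflTransGen.cases_head hx with h' | ⟨w, hw, -⟩
  · exact h'.symm
  · exact absurd hw (h w)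

/-- In a configuration without reduction, `k` is the indicator of a single vertex. -/
theorem Good.odd_structure (hG : Good E v J) (hd : inc E v = 1) (hk : Inv E v J k)
    (hs : nsum E v k = 1) {b : V} (hb : s(v, b) ∈ E) (hkb : k b = 0) (hC : ¬Coverable E)
    (ih : ∀ J' k', Good E v J' → Inv E v J' k' → nsum E v k' = 1 → k' b = 0 →
      (∀ x, k' x = 1 → k x = 1) → (∃ x, k x = 1 ∧ k' x = 0) → Coverable E) :
    ∃ a, s(v, a) ∈ E ∧ inc (E \ J) a = 1 ∧ inc (E \ J) b = 0 ∧ s(a, b) ∈ J ∧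
      (∀ w, ¬Fadj E v J a w) ∧ ∀ x, k x = 1 ↔ x = a := by
  have hbv : b ≠ v := fun h => hG.loopless v (by rwa [h] at hb)
  have hb0 : inc (E \ J) b = 0 := (zmod_two_cases _).resolve_right fun h =>
    hC (hG.odd_of_odd hd hk hs hb hkb h)
  have hkq : ∀ q, s(q, b) ∈ J → k q = 1 := fun q hq => (zmod_two_cases _).resolve_left fun h =>
    hC (hG.odd_of_base hd hk hs hb hkb hb0 hq h)
  obtain ⟨q, hq⟩ := exists_of_inc (hG.one b hbv)
  rw [Sym2.eq_swap] at hq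
  obtain ⟨c, hc, hrc, hcb⟩ : ∃ c, s(v, c) ∈ E ∧ Reach E v J b c ∧ c ≠ b := by
    by_contra! h
    exact hC (hG.odd_alone hd hk hs hb hkb hb0 hq h)
  have hind : ∀ q, s(q, b) ∈ J → ∀ x, k x = 1 → Reach E v J q x := by
    intro q hq x hx
    by_contra hr
    have h1 : ∀ x, ind E v J q x = 1 → k x = 1 := fun x hx => by
      rw [← hk.reach (bit_eq_one.1 hx), hkq q hq]
    have h2 : ind E v J q b = 0 := bit_neg (hG.not_reach hq)
    rcases zmod_two_cases (nsum E v (ind E v J q)) with h | h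
    · refine hC (ih J (fun x => k x + ind E v J q x) hG (fun u w huw => ?_) ?_ ?_ ?_ ⟨q, ?_, ?_⟩)
      · simp only [hk u w huw, ind_inv q u w huw]
      · rw [nsum_add, hs, h, add_zero]
      · simp only [hkb, h2, add_zero]
      · intro x hx
        rcases zmod_two_cases (ind E v J q x) with h' | h'
        · rwa [h', add_zero] at hx
        · exact h1 x h'
      · exact hkq q hq
      · simp only [hkq q hq, ind_self]; decide
    · exact hC (ih J _ hG (ind_inv q) h h2 h1 ⟨x, hx, bit_neg hr⟩)
  have hodd : ∀ q, s(q, b) ∈ J → inc (E \ J) q = 1 := by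
    intro q hq
    refine (zmod_two_cases _).resolve_left fun h0 => ?_
    obtain ⟨p, hpb, hp⟩ := hG.exists_other hq hc hcb hrc.symm
    refine hC (hG.odd_base_even hd hk hs hb hkb hb0 hq h0 ?_ hp hpb ?_)
    · by_contra! hiso
      obtain ⟨x, hx, hkx⟩ := exists_of_nsum hs
      have := (hind q hq x hkx).eq_of_isolated fun w hw => hiso w hw.1
      subst this
      refine hiso v (mem_sdiff.2 ⟨by rwa [Sym2.eq_swap], fun h => hG.zero x ?_⟩)
      rwa [Sym2.eq_swap]
    · exact (zmod_two_cases _).resolve_right fun h => hG.not_reach hp (hind q hq p h)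
  have hjump : ∀ (q u : V) (g : V → ZMod 2), s(q, b) ∈ J → Fadj E v J q u → g q = 0 →
      (∀ x y, Fadj E v J x y → g x + g y = bit (s(x, y) = s(q, u))) →
      nsum E v (fun x => k x * g x) = 1 := fun q u g hq hqu hgq hg =>
    (zmod_two_cases _).resolve_left fun h =>
      hC (hG.odd_base_odd hd hk hs hb hkb hb0 hq (hodd q hq) (hkq q hq) hqu hgq hg h)
  have huniq : ∀ q', s(q', b) ∈ J → q' = q := by
    intro q' hq'
    by_contra hne
    have hbq : s(b, q) ∈ J := by rwa [Sym2.eq_swap]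
    have hbq' : s(b, q') ∈ J := by rwa [Sym2.eq_swap]
    rcases hG.short_path hbq hbq' (Ne.symm hne) (hind q hq q' (hkq q' hq')) with h | ⟨w, h, h'⟩
    · obtain ⟨g, g1, g2, hg⟩ := hG.jump h
      have h1 := hjump q q' g hq h g1 hg
      have h2 := hjump q' q (fun x => g x + 1) hq' h.symm (by simp only [g2]; decide)
        (fun x y hxy => by rw [Sym2.eq_swap (a := q'), ← hg x y hxy]; grind)
      simp only [mul_add, mul_one] at h2
      rw [nsum_add, hs, h1] at h2
      exact absurd h2 (by decide)
    · obtain ⟨g₁, h10, h11, h1⟩ := hG.jump h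
      obtain ⟨g₂, h20, h21, h2⟩ := hG.jump h'.symm
      have e1 := hjump q w g₁ hq h h10 h1
      have e2 := hjump q' w g₂ hq' h'.symm h20 h2
      refine hC (ih _ _ (hG.swap hbq hbq' (Ne.symm hne) h h')
        (Inv.swap (Ne.symm hne) h h' hk hkb h10 h11 h20 h21 h1 h2) ?_ ?_ ?_ ⟨q, hkq q hq, ?_⟩)
      · simp only [mul_add, mul_one]
        rw [nsum_add, nsum_add, hs, e1, e2]
        decide
      · simp only [hkb, zero_mul]
      · intro x hx
        exact (zmod_two_cases _).resolve_left fun h0 => by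
          rw [h0, zero_mul] at hx; exact absurd hx (by decide)
      · have e3 := h2 q w h
        rw [bit_neg (by rw [Sym2.congr_left]; exact Ne.symm hne)] at e3
        simp only [h10]
        grind
  have hN : ∀ x, s(v, x) ∈ E → k x = 1 → x = q := by
    intro x hx hkx
    by_contra hne
    obtain ⟨q', hq', hbq'⟩ := hG.exists_other (b := b) (q := q) (by rwa [Sym2.eq_swap]) hx hne
      (hind q hq x hkx).symm
    exact hq' (huniq q' (by rwa [Sym2.eq_swap]))
  obtain ⟨x, hx, hkx⟩ := exists_of_nsum hs
  have hqN : s(v, q) ∈ E := by rwa [← hN x hx hkx]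
  have hiso : ∀ w, ¬Fadj E v J q w := by
    intro w hw
    obtain ⟨g, g1, g2, hg⟩ := hG.jump hw
    have h1 := hjump q w g hq hw g1 hg
    rw [nsum_single hqN fun x hx hne => ?_] at h1
    · rw [g1, mul_zero] at h1; exact absurd h1 (by decide)
    · rw [(zmod_two_cases (k x)).resolve_right fun h => hne (hN x hx h), zero_mul]
  exact ⟨q, hqN, hodd q hq, hb0, hq, hiso, fun x =>
    ⟨fun h => (hind q hq x h).eq_of_isolated hiso, fun h => h ▸ hkq q hq⟩⟩

theorem nsum_delta {a : V} (ha : s(v, a) ∈ E) (i : ZMod 2) :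
    nsum E v (fun x => i * bit (x = a)) = i := by
  rw [nsum_single ha fun x _ hx => by rw [bit_neg hx, mul_zero], bit_pos rfl, mul_one]

theorem nsum_triple {a c c' : V} (ha : s(v, a) ∈ E) (hc : s(v, c) ∈ E) (hc' : s(v, c') ∈ E)
    (h1 : a ≠ c) (h2 : a ≠ c') (h3 : c ≠ c')
    (h : ∀ x, s(v, x) ∈ E → x = a ∨ x = c ∨ x = c') (g : V → ZMod 2) :
    nsum E v g = g a + g c + g c' := by
  rw [nsum_congr (h := fun x => g a * bit (x = a) + g c * bit (x = c) + g c' * bit (x = c')),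
    nsum_add, nsum_add, nsum_delta ha, nsum_delta hc, nsum_delta hc']
  intro x hx
  rcases h x hx with rfl | rfl | rfl
  · simp [bit, h1, h2]
  · simp [bit, h1.symm, h3]
  · simp [bit, h2.symm, h3.symm]

theorem inv_delta {a : V} (h : ∀ w, ¬Fadj E v J a w) (i : ZMod 2) :
    Inv E v J (fun x => i * bit (x = a)) := by
  intro u w huw
  have h1 : u ≠ a := fun h' => h w (h' ▸ huw)
  have h2 : w ≠ a := fun h' => h u (h' ▸ huw.symm)
  simp only [bit_neg h1, bit_neg h2]

theorem Good.odd_star_triple (hG : Good E v J) (hd : inc E v = 1) {a c c' r : V}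
    (ha : s(v, a) ∈ E) (ha1 : inc (E \ J) a = 1)
    (hc : s(v, c) ∈ E) (hc' : s(v, c') ∈ E) (hc0 : inc (E \ J) c = 0)
    (hc0' : inc (E \ J) c' = 0) (hJ : s(a, c) ∈ J) (hJ' : s(a, c') ∈ J) (hJr : s(a, r) ∈ J)
    (h3 : c ≠ c') (hrc : r ≠ c) (hrc' : r ≠ c')
    (h : ∀ x, s(v, x) ∈ E → x = a ∨ x = c ∨ x = c')
    {e : V → V} {f t y : V → ZMod 2} (hf : Solves E v J e f)
    (hae : e a = a ∧ t a = 0) (hce : e c = c ∧ t c = 0) (hce' : e c' = c' ∧ t c' = 0)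
    (hr : LocalOK E v J a {c, c', r} f t y e r) (hy : y c = f c) (hy' : y c' = f c')
    (hfa : f a = f c') (hne : f c ≠ y r)
    (hS : ∀ u, u ∉ ({a, c, c', r} : Finset V) → u ≠ v → Std E v J e t u) : Coverable E := by
  have h1 := (hG.ne_of_mem hJ).2.2
  have h2 := (hG.ne_of_mem hJ').2.2
  have h4 := (hG.ne_of_mem hJr).2.2
  have hm : c ∉ ({c', r} : Finset V) := by simp [h3, hrc.symm]
  have hm' : c' ∉ ({r} : Finset V) := by simp [hrc'.symm]
  refine hG.odd_even hd hc hc0 (q := a) (B := {c, c', r}) (by simp [hJ, hJ', hJr]) (by simp) hf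
    (y := y) hy hce.1 ?_ (fun p hp hpc => ?_) (fun u hu hua huv => hS u (by simp_all) huv) ?_
  · refine local_base_zero (by simp [h1, h2, h4]) ?_ ?_
    · rw [ha1, card_insert_of_notMem hm, card_insert_of_notMem hm', card_singleton]; decide
    · rw [sum_insert hm, sum_insert hm', sum_singleton, (hG.mono_self hae.1 hae.2).spec, ha1,
        hfa, hy, hy', zmod_two_ne hne]
      grind
  · have hp : p = c' ∨ p = r := by simpa [hpc] using hp
    rcases hp with rfl | rfl
    · exact local_mem_even (by simp) h2.symm hc0' (hG.mono_self hce'.1 hce'.2) hy'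
    · exact hr
  · rw [nsum_triple ha hc hc' h1 h2 h3 h, hae.2, hce.2, hce'.2, hfa]
    grind

/-- The case where `v` has degree three and a neighbour `a` with all other neighbours attached
to it. -/
theorem Good.odd_star_three (hG : Good E v J) (hd : inc E v = 1) {a c c' : V}
    (ha : s(v, a) ∈ E) (ha1 : inc (E \ J) a = 1) (hiso : ∀ w, ¬Fadj E v J a w)
    (hc : s(v, c) ∈ E) (hc' : s(v, c') ∈ E) (hc0 : inc (E \ J) c = 0)
    (hc0' : inc (E \ J) c' = 0) (hJ : s(a, c) ∈ J) (hJ' : s(a, c') ∈ J) (h3 : c ≠ c')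
    (h : ∀ x, s(v, x) ∈ E → x = a ∨ x = c ∨ x = c') : Coverable E := by
  have hav := (hG.ne_of_mem hJ).1
  have h1 := (hG.ne_of_mem hJ).2.2
  have h2 := (hG.ne_of_mem hJ').2.2
  obtain ⟨r, hrc, hrc', hJr⟩ := exists_third (hG.one a hav) hJ hJ' h3
  have h4 := (hG.ne_of_mem hJr).2.2
  have hrN : s(v, r) ∉ E := fun hr => by
    rcases h r hr with h | h | h
    · exact h4 h.symm
    · exact hrc h
    · exact hrc' h
  obtain ⟨e, t, hM, hS⟩ := hG.exists_pattern {a, c, c', r} id 0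
  have hae := hM a (by simp)
  have hce := hM c (by simp)
  have hce' := hM c' (by simp)
  have hre := hM r (by simp)
  simp only [id, Pi.zero_apply] at hae hce hce' hre
  obtain ⟨f, hf⟩ := hG.solve e
  have hloc : ∀ (B : Finset V) (i : ZMod 2) (t : V → ZMod 2), r ∈ B → LocalOK E v J a B
      (fun x => f x + i * bit (x = a)) t
      (fun x => if x = r then f r + inc (E \ J) r else f x) e r := by
    intro B i t hB
    rcases zmod_two_cases (inc (E \ J) r) with h0 | h0
    · refine local_mem_even hB h4.symm h0 ⟨by rw [hre.1]; exact hG.not_fadj_self r,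
        fun h => absurd h hrN⟩ (by simp [h0, bit, h4.symm])
    · refine local_mem_odd hB h4.symm h0 ?_
      rw [hG.spec_self hre.1, bit_neg hrN, bit_neg h4.symm, if_pos rfl, h0]
      grind
  by_cases hA : f c = f r + inc (E \ J) r
  · by_cases hB : f c' = f r + inc (E \ J) r
    · rw [← hG.inc_compl_zero] at hd
      have ht : ∀ u, u ≠ c → u ≠ c' →
          (fun x => t x + (bit (x = c) + bit (x = c'))) u = t u := fun u h1 h2 => by
        simp [bit, h1, h2]
      have hstd : ∀ u, u ∉ ({a, r} : Finset V) → u ≠ v →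
          Std E v J e (fun x => t x + (bit (x = c) + bit (x = c'))) u := by
        intro u hu huv
        by_cases hu1 : u = c
        · subst hu1
          refine Or.inr (Or.inl ⟨hc0, ?_⟩)
          rw [hG.spec_self hce.1, bit_pos hc]
          simp [hce.2, bit, h3]
        by_cases hu2 : u = c'
        · subst hu2
          refine Or.inr (Or.inl ⟨hc0', ?_⟩)
          rw [hG.spec_self hce'.1, bit_pos hc']
          simp [hce'.2, bit, h3.symm]
        exact (hS u (by simp_all) huv).congr rfl (ht u hu1 hu2)
      refine coverable_of_colour hG a {r} v
        (fun x => f x + (f a + f c + 1) * bit (x = a)) (fun x => t x + (bit (x = c) + bit (x = c')))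
        (fun x => if x = r then f r + inc (E \ J) r else f x) e
        (hf.shift (inv_delta hiso _)) (by simpa using hJr) (by simp)
        (fun u huv _ => ?_) (by simp) (Or.inr (Or.inl ⟨rfl, hd, f c + 1, ?_⟩))
      · by_cases hua : u = a
        · subst hua
          refine local_base_zero (by simpa using h4) (by rw [ha1, card_singleton]; decide) ?_
          rw [(hG.mono_self hae.1 ((ht u h1 h2).trans hae.2)).spec, ha1, sum_singleton,
            if_pos rfl, bit_pos rfl, ← hA]
          grind
        by_cases hur : u = r
        · subst hur
          exact hloc _ _ _ (by simp)
        exact (hstd u (by simp [hua, hur]) huv).localOK (by simpa using hur) hua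
      · intro x hx
        rcases h x hx with rfl | rfl | rfl
        · simp [bit, h1, h2, hae.2]; grind
        · simp [bit, h1.symm, h3, hce.2]
        · simp [bit, h2.symm, h3.symm, hce'.2, hA, hB]
    · refine hG.odd_star_triple hd ha ha1 hc' hc hc0' hc0 hJ' hJ hJr h3.symm hrc' hrc
        (fun x hx => by have := h x hx; tauto)
        (hf.shift (inv_delta hiso (f a + f c))) hae hce' hce (hloc _ _ _ (by simp)) ?_ ?_ ?_ ?_
        (fun u hu huv => hS u (by simp_all) huv)
      · simp [bit, h2.symm, hrc'.symm]
      · simp [bit, h1.symm, hrc.symm]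
      · simp [bit, h1.symm]; grind
      · simpa [bit, h2.symm] using hB
  · refine hG.odd_star_triple hd ha ha1 hc hc' hc0 hc0' hJ hJ' hJr h3 hrc hrc' h
      (hf.shift (inv_delta hiso (f a + f c'))) hae hce hce' (hloc _ _ _ (by simp)) ?_ ?_ ?_ ?_ hS
    · simp [bit, h1.symm, hrc.symm]
    · simp [bit, h2.symm, hrc'.symm]
    · simp [bit, h2.symm]; grind
    · simpa [bit, h1.symm] using hA

theorem Good.odd_star (hG : Good E v J) (hd : inc E v = 1) {a : V}
    (ha : s(v, a) ∈ E) (ha1 : inc (E \ J) a = 1) (hiso : ∀ w, ¬Fadj E v J a w)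
    (h : ∀ c, s(v, c) ∈ E → c ≠ a → inc (E \ J) c = 0 ∧ s(a, c) ∈ J) : Coverable E := by
  obtain ⟨e, t, hM, hS⟩ := hG.exists_pattern {x | s(v, x) ∈ E} id (fun x => inc (E \ J) x + 1)
  have hM : ∀ x, s(v, x) ∈ E → e x = x ∧ t x = inc (E \ J) x + 1 := fun x hx =>
    hM x (by simpa using hx)
  have hS : ∀ u, u ≠ v → Std E v J e t u := by
    intro u hu
    by_cases hN : s(v, u) ∈ E
    · exact hG.toggle_std hN (hM u hN).1 (hM u hN).2
    · exact hS u (by simpa using hN) hu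
  have hta : t a = 0 := by rw [(hM a ha).2, ha1]; rfl
  have htc : ∀ c, s(v, c) ∈ E → c ≠ a → t c = 1 := fun c hc hca => by
    rw [(hM c hc).2, (h c hc hca).1]; rfl
  obtain ⟨f, hf⟩ := hG.solve e
  by_cases hX : nsum E v (fun x => f x + t x) = f a + t a
  · exact hG.odd_single hd ha ha1 hf hS hX
  obtain ⟨c, c', hc, hca, hc', hca', hff⟩ : ∃ c c', s(v, c) ∈ E ∧ c ≠ a ∧ s(v, c') ∈ E ∧ c' ≠ a ∧
      f c ≠ f c' := by
    by_contra! hcon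
    obtain ⟨i, hi⟩ : ∃ i, ∀ x, s(v, x) ∈ E → x ≠ a → f x + t x = i := by
      by_cases hex : ∃ c, s(v, c) ∈ E ∧ c ≠ a
      · obtain ⟨c, hc, hca⟩ := hex
        exact ⟨f c + 1, fun x hx hxa => by rw [htc x hx hxa, hcon x c hx hxa hc hca]⟩
      · exact ⟨0, fun x hx hxa => absurd ⟨x, hx, hxa⟩ hex⟩
    apply hX
    rw [nsum_congr (h := fun x => i + (f a + t a + i) * bit (x = a)), nsum_add, nsum_const,
      nsum_delta ha, hd]
    · grind
    · intro x hx
      by_cases hxa : x = a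
      · rw [hxa, bit_pos rfl]; grind
      · rw [hi x hx hxa, bit_neg hxa]; ring
  have hcc : c ≠ c' := fun h => hff (by rw [h])
  obtain ⟨hc0, hJ⟩ := h c hc hca
  obtain ⟨hc0', hJ'⟩ := h c' hc' hca'
  by_cases hb : ∃ b, s(v, b) ∈ E ∧ b ≠ a ∧ b ≠ c ∧ b ≠ c'
  swap
  · exact hG.odd_star_three hd ha ha1 hiso hc hc' hc0 hc0' hJ hJ' hcc
      (fun x hx => by by_contra! hx'; exact hb ⟨x, hx, hx'⟩)
  obtain ⟨b, hb, hba, hbc, hbc'⟩ := hb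
  obtain ⟨hb0, hJb⟩ := h b hb hba
  have hm : b ∉ ({c, c'} : Finset V) := by simp [hbc, hbc']
  have hm' : c ∉ ({c'} : Finset V) := by simp [hcc]
  refine hG.odd_even hd hb hb0 (q := a) (B := {b, c, c'}) (by simp [hJ, hJ', hJb]) (by simp)
    (hf.shift (inv_delta hiso (f a + f b)))
    (t := fun x => t x + (1 * bit (x = c) + 1 * bit (x = c'))) (y := f) ?_ (hM b hb).1 ?_
    (fun p hp hpb => ?_) (fun u hu hua huv => ?_) ?_
  · simp [bit, hba]
  · refine local_base_zero (by simp [hba.symm, hca.symm, hca'.symm]) ?_ ?_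
    · rw [ha1, card_insert_of_notMem hm, card_insert_of_notMem hm', card_singleton]; decide
    · rw [sum_insert hm, sum_insert hm', sum_singleton, (hG.mono_self (hM a ha).1 ?_).spec, ha1,
        bit_pos rfl, zmod_two_ne hff]
      · grind
      · simp [bit, hta, hca.symm, hca'.symm]
  · have hp : p = c ∨ p = c' := by simpa [hpb] using hp
    rcases hp with rfl | rfl
    · refine local_mem_even (by simp) hca hc0 (hG.mono_self (hM p hc).1 ?_) (by simp [bit, hca])
      simp [bit, hcc, htc p hc hca]; decide
    · refine local_mem_even (by simp) hca' hc0' (hG.mono_self (hM p hc').1 ?_) (by simp [bit, hca'])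
      simp [bit, hcc.symm, htc p hc' hca']; decide
  · simp only [mem_insert, mem_singleton, not_or] at hu
    exact (hS u huv).congr rfl (by simp [bit, hu])
  · have h' := zmod_two_ne hX
    rw [nsum_add] at h'
    rw [nsum_add, nsum_add, nsum_add, nsum_add, nsum_delta ha, nsum_delta hc, nsum_delta hc',
      bit_neg hba, bit_neg hbc, bit_neg hbc', htc b hb hba]
    grind

theorem odd_induction (hd : inc E v = 1) (n : ℕ) : ∀ J k, Good E v J → Inv E v J k →
    nsum E v k = 1 → (∃ b, s(v, b) ∈ E ∧ k b = 0) → #{x | k x = 1} ≤ n → Coverable E := by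
  induction n with
  | zero =>
    intro J k _ _ hs _ h
    obtain ⟨x, -, hx⟩ := exists_of_nsum hs
    have h0 := card_eq_zero.1 (Nat.le_zero.1 h)
    exact absurd hx (filter_eq_empty_iff.1 h0 (mem_univ x))
  | succ n ih =>
    intro J k hG hk hs hb hn
    by_contra hC
    have key := fun b (hb : s(v, b) ∈ E) (hkb : k b = 0) =>
      hG.odd_structure hd hk hs hb hkb hC fun J' k' hG' hk' hs' hb' hsub ⟨x, hx, hx'⟩ => by
        refine ih J' k' hG' hk' hs' ⟨b, hb, hb'⟩ (Nat.lt_succ_iff.1 (lt_of_lt_of_le ?_ hn))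
        refine card_lt_card ((ssubset_iff_of_subset fun z hz => ?_).2 ⟨x, by simpa using hx, ?_⟩)
        · simp only [mem_filter, mem_univ, true_and] at hz ⊢
          exact hsub z hz
        · simp [hx']
    obtain ⟨b, hb, hkb⟩ := hb
    obtain ⟨a, ha, ha1, -, -, hiso, hka⟩ := key b hb hkb
    refine hC (hG.odd_star hd ha ha1 hiso fun c hc hca => ?_)
    obtain ⟨a', -, -, h1, h2, -, h3⟩ := key c hc
      ((zmod_two_cases _).resolve_right fun h => hca ((hka c).1 h))
    have : a' = a := (hka a').1 ((h3 a').2 rfl)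
    exact ⟨h1, this ▸ h2⟩

theorem Good.coverable_odd (hG : Good E v J) (hd : inc E v = 1) : Coverable E := by
  obtain ⟨a, ha⟩ := exists_of_inc hd
  by_cases hall : ∀ x, s(v, x) ∈ E → Reach E v J a x
  · exact hG.odd_reached hd fun x y hx hy => (hall x hx).symm.trans (hall y hy)
  push Not at hall
  obtain ⟨b, hb, hab⟩ := hall
  rcases zmod_two_cases (nsum E v (ind E v J a)) with h | h
  · refine odd_induction hd _ J (fun x => 1 + ind E v J a x) hG (fun u w huw => ?_) ?_
      ⟨a, ha, ?_⟩ le_rfl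
    · simp only [ind_inv a u w huw]
    · rw [nsum_add, nsum_const, h, hd]; decide
    · simp only [ind_self]; decide
  · exact odd_induction hd _ J _ hG (ind_inv a) h ⟨b, hb, bit_neg hab⟩ le_rfl

theorem exists_join {Y₀ : Finset (Sym2 V)} (h₀ : ∀ u, s(u, u) ∉ Y₀) {x : V} (U : Finset V)
    (hU : ∀ a ∈ U, Relation.ReflTransGen (fun u w => s(u, w) ∈ Y₀) x a) :
    ∃ Y ⊆ Y₀, ∀ u, inc Y u = bit (u ∈ U) + (#U : ZMod 2) * bit (u = x) := by
  induction U using Finset.induction_on with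
  | empty => exact ⟨∅, empty_subset _, fun u => by simp [inc_empty, bit]⟩
  | insert a U ha ih =>
    obtain ⟨Y, hY, h1⟩ := ih fun b hb => hU b (mem_insert_of_mem hb)
    obtain ⟨Z, hZ, h2, -⟩ := exists_chain h₀ (hU a (mem_insert_self a U))
    refine ⟨symmDiff Y Z, fun e he => ?_, fun u => ?_⟩
    · rcases mem_symmDiff.1 he with ⟨h, -⟩ | ⟨h, -⟩
      · exact hY h
      · exact hZ h
    · rw [inc_symmDiff, h1, h2, card_insert_of_notMem ha, mem_insert, bit_or]
      · push_cast; ring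
      · rintro ⟨rfl, h⟩; exact ha h

theorem coverable_of_perfect (hloop : ∀ u, s(u, u) ∉ E) (hJ : J ⊆ E) (hone : ∀ u, inc J u = 1)
    (hmax : ∀ J' ⊆ E, (∀ u, inc J' u = 1) → #J' ≤ #J) : Coverable E := by
  have hF : ∀ Z ⊆ E \ J, (∀ u, inc Z u = 0) → Z = ∅ := by
    intro Z hZ h
    have hd : Disjoint J Z := disjoint_of_subset_right hZ disjoint_sdiff
    have := hmax (J ∪ Z) (union_subset hJ (hZ.trans sdiff_subset)) fun u => by
      rw [inc_union hd, hone, h, add_zero]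
    rw [card_union_of_disjoint hd] at this
    exact card_eq_zero.1 (by omega)
  have hex : ∀ u, ∃ x, (∀ w, s(u, w) ∉ E \ J) ∨ (inc (E \ J) u = 0 ∧ s(u, x) ∈ E \ J) ∨
      (inc (E \ J) u = 1 ∧ x = u) := by
    intro u
    by_cases h : ∀ w, s(u, w) ∉ E \ J
    · exact ⟨u, Or.inl h⟩
    rcases zmod_two_cases (inc (E \ J) u) with h0 | h0
    · push Not at h
      obtain ⟨x, hx⟩ := h
      exact ⟨x, Or.inr (Or.inl ⟨h0, hx⟩)⟩
    · exact ⟨u, Or.inr (Or.inr ⟨h0, rfl⟩)⟩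
  choose e he using hex
  obtain ⟨f, hf⟩ := exists_potential (fun u hu => hloop u (mem_sdiff.1 hu).1) hF
    (fun u w => bit (e u = w) + bit (e w = u)) (fun _ _ => add_comm _ _)
  obtain ⟨A₀, A₁, h0, h1, h01⟩ := exists_oddSet_pair (empty_subset (E \ J))
    (fun u w => f u + bit (e u = w)) (fun u w h => by have := hf u w h; grind) fun u => by
      rcases he u with h | ⟨h1, h2⟩ | ⟨h1, h2⟩
      · exact Or.inl h
      · refine Or.inr (Or.inl ⟨by simp, h1, ?_⟩)
        have : ∀ w, bit (s(u, w) ∈ E \ J) * (f u + bit (e u = w)) =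
            bit (s(u, w) ∈ E \ J) * f u + bit (w = e u) * bit (s(u, w) ∈ E \ J) := fun w => by
          rw [show (w = e u) = (e u = w) from propext eq_comm]; ring
        simp only [this]
        rw [sum_add_distrib, ← sum_mul, ← inc_eq_bit, h1, sum_bit_eq, bit_pos h2]
        ring
      · refine Or.inr (Or.inr (Or.inl ⟨by simp, h1, f u, fun w hw => ?_⟩))
        rw [bit_neg, add_zero]
        rintro rfl
        rw [h2] at hw
        exact hloop u (mem_sdiff.1 hw).1
  exact ⟨A₀, A₁, J, h0, h1, fun u => Or.inr (hone u), by rw [h01]; exact sdiff_union_of_subset hJ⟩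

theorem coverable_of_connected (hloop : ∀ u, s(u, u) ∉ E) (v : V)
    (hc : ∀ x z, Relation.ReflTransGen (fun u w => s(u, w) ∈ E) x z)
    (hv : ∀ x z, x ≠ v → z ≠ v →
      Relation.ReflTransGen (fun u w => s(u, w) ∈ E ∧ u ≠ v ∧ w ≠ v) x z) : Coverable E := by
  classical
  rcases zmod_two_cases ((#(univ : Finset V) : ℕ) : ZMod 2) with hV | hV
  · obtain ⟨Y, hY, h1⟩ := exists_join hloop univ fun a _ => hc v a
    obtain ⟨J, hJ, hmax⟩ := exists_max_image {J ∈ E.powerset | ∀ u, inc J u = 1} (fun J => #J)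
      ⟨Y, by
        simp only [mem_filter, mem_powerset, h1, hV, zero_mul, add_zero]
        exact ⟨hY, fun u => bit_pos (mem_univ u)⟩⟩
    simp only [mem_filter, mem_powerset] at hJ hmax
    exact coverable_of_perfect hloop hJ.1 hJ.2 fun J' h h' => hmax J' ⟨h, h'⟩
  by_cases hx : ∃ x, x ≠ v
  swap
  · push Not at hx
    refine ⟨∅, ∅, ∅, fun u => by simp, fun u => by simp, fun u => by simp, ?_⟩
    rw [eq_comm, empty_union, empty_union, eq_empty_iff_forall_notMem]
    intro e he
    induction e with | _ a b => exact hloop v (by rwa [hx a, hx b] at he)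
  obtain ⟨x, hx⟩ := hx
  obtain ⟨Y, hY, h1⟩ := exists_join (Y₀ := {e ∈ E | v ∉ e}) (fun u h => hloop u (mem_filter.1 h).1)
    (x := x) (univ.erase v) fun a ha => (hv x a hx (ne_of_mem_erase ha)).lift id fun u w h => by
      simp only [mem_filter, Sym2.mem_iff]
      exact ⟨h.1, by simp [h.2.1.symm, h.2.2.symm]⟩
  have hcard : ((#(univ.erase v) : ℕ) : ZMod 2) = 0 := by
    rw [← card_erase_add_one (mem_univ v)] at hV
    push_cast at hV
    grind
  obtain ⟨J, hJ, hmax⟩ := exists_max_image {J ∈ E.powerset | ∃ v', (∀ w, s(v', w) ∉ J) ∧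
      ∀ u, u ≠ v' → inc J u = 1} (fun J => #J) ⟨Y, by
    simp only [mem_filter, mem_powerset]
    refine ⟨hY.trans (filter_subset _ _), v, fun w hw => ?_, fun u hu => ?_⟩
    · exact (mem_filter.1 (hY hw)).2 (Sym2.mem_mk_left v w)
    · rw [h1, hcard, zero_mul, add_zero]
      exact bit_pos (by simp [hu])⟩
  simp only [mem_filter, mem_powerset] at hJ hmax
  obtain ⟨hJE, b, hb0, hb1⟩ := hJ
  have hG : Good E b J := ⟨hloop, hJE, hb0, hb1, fun v' J' h h' h'' => hmax J' ⟨h, v', h', h''⟩⟩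
  rcases zmod_two_cases (inc E b) with hd | hd
  · obtain ⟨a, ha⟩ : ∃ a, s(b, a) ∈ E := by
      obtain ⟨z, hz⟩ : ∃ z, z ≠ b := by
        by_cases h : x = b
        · exact ⟨v, fun h' => hx (h.trans h'.symm)⟩
        · exact ⟨x, h⟩
      rcases Relation.ReflTransGen.cases_head (hc b z) with h | ⟨w, hw, -⟩
      · exact absurd h.symm hz
      · exact ⟨w, hw⟩
    exact coverable_even _ ha hd J hG le_rfl
  · exact hG.coverable_odd hd

theorem OddSet.card {Y : Finset (Sym2 V)} (h : OddSet Y) (u : V) :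
    #{e ∈ Y | u ∈ e} = 0 ∨ Odd #{e ∈ Y | u ∈ e} := by
  rcases h u with h | h
  · left
    rw [card_eq_zero, filter_eq_empty_iff]
    rintro e he hu
    obtain ⟨w, rfl⟩ := Sym2.mem_iff_exists.1 hu
    exact h w he
  · right
    rwa [inc_eq_card, ZMod.natCast_eq_one_iff_odd] at h

end OddCover

/-- Every connected simple graph admits an odd 3-edge-covering: an assignment of
nonempty subsets of `{1,2,3}` to the edges such that each color class induces a
subgraph in which all non-isolated vertices have odd degree. -/
theorem stmt_13 {V : Type*} [Fintype V] (G : SimpleGraph V) (hG : G.Connected) :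
    ∃ ψ : Sym2 V → Finset (Fin 3),
      (∀ e ∈ G.edgeSet, (ψ e).Nonempty) ∧
      (∀ (j : Fin 3) (v : V),
        {e | e ∈ G.edgeSet ∧ j ∈ ψ e ∧ v ∈ e}.ncard = 0 ∨
          Odd {e | e ∈ G.edgeSet ∧ j ∈ ψ e ∧ v ∈ e}.ncard) := by
  classical
  obtain ⟨v, hv⟩ := hG.exists_preconnected_induce_compl_singleton_of_finite
  obtain ⟨A₀, A₁, A₂, h0, h1, h2, hA⟩ := OddCover.coverable_of_connected (E := G.edgeFinset)
    (by simp) v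
    (fun x z => ((SimpleGraph.reachable_iff_reflTransGen x z).1 (hG.preconnected x z)).lift id
      fun a b h => SimpleGraph.mem_edgeFinset.2 h)
    (fun x z hx hz => ((SimpleGraph.reachable_iff_reflTransGen _ _).1
      (hv ⟨x, hx⟩ ⟨z, hz⟩)).lift Subtype.val fun a b h => by
        refine ⟨?_, a.2, b.2⟩
        simpa using h)
  have hodd : ∀ j, OddCover.OddSet (![A₀, A₁, A₂] j) := by
    intro j; fin_cases j <;> assumption
  have hmem : ∀ e, e ∈ G.edgeSet ↔ ∃ j, e ∈ ![A₀, A₁, A₂] j := by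
    intro e
    rw [← SimpleGraph.mem_edgeFinset, ← hA]
    simp [Fin.exists_fin_succ]
  refine ⟨fun e => {j | e ∈ ![A₀, A₁, A₂] j}, fun e he => ?_, fun j u => ?_⟩
  · obtain ⟨j, hj⟩ := (hmem e).1 he
    exact ⟨j, by simpa using hj⟩
  · have : {e | e ∈ G.edgeSet ∧ j ∈ ({j | e ∈ ![A₀, A₁, A₂] j} : Finset (Fin 3)) ∧ u ∈ e} =
        ({e ∈ ![A₀, A₁, A₂] j | u ∈ e} : Finset (Sym2 V)) := by
      ext e
      simp only [Set.mem_ofPred_eq, Finset.coe_filter, Finset.mem_filter, Finset.mem_univ, true_and]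
      exact ⟨fun h => h.2, fun h => ⟨(hmem e).2 ⟨j, h.1⟩, h⟩⟩
    rw [this, Set.ncard_coe_finset]
    exact (hodd j).card u
end

section
/- Let G be a connected simple graph of odd order that has a cut vertex v such that G − v has a connected component of odd order. Then G has an odd 3-edge-covering with overlap at most 2. -/
/-- The number of edges of the finite set `A` that contain the vertex `u`. -/
def edgeDegree {V : Type*} [DecidableEq V] (A : Finset (Sym2 V)) (u : V) : ℕ :=
  (A.filter (u ∈ ·)).card

/-- A finite set of edges is independent over the field with two elements, i.e. it contains no
nonempty subset with all degrees even. -/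
def EdgeIndependent {V : Type*} [DecidableEq V] (A : Finset (Sym2 V)) : Prop :=
  ∀ Z ⊆ A, (∀ u, Even (edgeDegree Z u)) → Z = ∅

section EdgeDegree

variable {V : Type*} [DecidableEq V] {A B : Finset (Sym2 V)} {u : V}

theorem edgeDegree_union_of_disjoint (h : Disjoint A B) (u : V) :
    edgeDegree (A ∪ B) u = edgeDegree A u + edgeDegree B u := by
  unfold edgeDegree
  rw [Finset.filter_union, Finset.card_union_of_disjoint]
  exact Finset.disjoint_filter_filter h

theorem edgeDegree_sdiff_add (h : A ⊆ B) (u : V) :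
    edgeDegree (B \ A) u + edgeDegree A u = edgeDegree B u := by
  rw [← edgeDegree_union_of_disjoint Finset.sdiff_disjoint, Finset.sdiff_union_of_subset h]

theorem edgeDegree_eq_zero (h : ∀ e ∈ A, u ∉ e) : edgeDegree A u = 0 := by
  unfold edgeDegree
  rw [Finset.card_eq_zero, Finset.filter_eq_empty_iff]
  exact h

theorem edgeDegree_insert_self {e : Sym2 V} (he : e ∉ A) (hu : u ∈ e) :
    edgeDegree (insert e A) u = edgeDegree A u + 1 := by
  unfold edgeDegree
  rw [Finset.filter_insert, if_pos hu, Finset.card_insert_of_notMem]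
  simp [he]

theorem edgeDegree_symmDiff_add_inter (A B : Finset (Sym2 V)) (u : V) :
    edgeDegree (symmDiff A B) u + 2 * edgeDegree (A ∩ B) u = edgeDegree A u + edgeDegree B u := by
  have h₁ := edgeDegree_sdiff_add (Finset.inter_subset_left : A ∩ B ⊆ A) u
  have h₂ := edgeDegree_sdiff_add (Finset.inter_subset_right : A ∩ B ⊆ B) u
  rw [Finset.sdiff_inter_self_left] at h₁
  rw [Finset.sdiff_inter_self_right] at h₂
  have h₃ : edgeDegree (symmDiff A B) u = edgeDegree (A \ B) u + edgeDegree (B \ A) u :=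
    edgeDegree_union_of_disjoint disjoint_sdiff_sdiff u
  omega

theorem natCast_edgeDegree_filter [Fintype V] (A : Finset (Sym2 V)) (x : Sym2 V → ZMod 2) (u : V) :
    ((edgeDegree (A.filter (x · = 1)) u : ℕ) : ZMod 2) =
      ∑ e ∈ A, if u ∈ e then x e else 0 := by
  unfold edgeDegree
  rw [Finset.filter_filter, Finset.card_filter, Nat.cast_sum]
  refine Finset.sum_congr rfl fun e _ => ?_
  have : ∀ a : ZMod 2, a = 0 ∨ a = 1 := by decide
  rcases this (x e) with h | h <;> by_cases hu : u ∈ e <;> simp [h, hu]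

/-- A nonempty loopless set of edges with all degrees even has more than two elements. -/
theorem two_lt_card_of_even_edgeDegree (hne : A.Nonempty) (hd : ∀ e ∈ A, ¬ e.IsDiag)
    (heven : ∀ u, Even (edgeDegree A u)) : 2 < A.card := by
  obtain ⟨e, he⟩ := hne
  have key : ∀ u ∈ e, ∃ f ∈ A, u ∈ f ∧ f ≠ e := by
    intro u hu
    have hmem : e ∈ A.filter (u ∈ ·) := by simp [he, hu]
    have hpos := Finset.card_pos.mpr ⟨e, hmem⟩
    have hev : Even (A.filter (u ∈ ·)).card := heven u
    have : 1 < (A.filter (u ∈ ·)).card := by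
      obtain ⟨k, hk⟩ := hev
      omega
    obtain ⟨f, hf, hfe⟩ := Finset.exists_mem_ne this e
    exact ⟨f, (Finset.mem_filter.mp hf).1, (Finset.mem_filter.mp hf).2, hfe⟩
  induction e using Sym2.ind with
  | _ a b =>
    obtain ⟨f, hf, haf, hfe⟩ := key a (by simp)
    obtain ⟨g, hg, hbg, hge⟩ := key b (by simp)
    have hab : a ≠ b := by simpa using hd _ he
    have hfg : f ≠ g := by
      rintro rfl
      exact hfe ((Sym2.mem_and_mem_iff hab).mp ⟨haf, hbg⟩)
    exact Finset.two_lt_card.mpr ⟨_, he, f, hf, g, hg, hfe.symm, hge.symm, hfg⟩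

end EdgeDegree

open Matrix in
/-- The Fredholm alternative for a matrix over a field. -/
theorem Matrix.exists_mulVec_eq_of_forall_vecMul_eq_zero {I J K : Type*} [Fintype I] [Fintype J]
    [DecidableEq I] [Field K] (M : Matrix I J K) (b : I → K)
    (h : ∀ y : I → K, y ᵥ* M = 0 → y ⬝ᵥ b = 0) : ∃ x : J → K, M *ᵥ x = b := by
  classical
  by_contra hb
  have hb' : b ∉ LinearMap.range M.mulVecLin := by simpa using hb
  obtain ⟨f, hfb, hf⟩ := Submodule.exists_dual_map_eq_bot_of_notMem hb' inferInstance
  have hdot : ∀ w : I → K, f w = (fun i => f (Pi.single i 1)) ⬝ᵥ w := by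
    intro w
    conv_lhs => rw [LinearMap.pi_apply_eq_sum_univ f w]
    simp only [dotProduct, smul_eq_mul]
    refine Finset.sum_congr rfl fun i _ => ?_
    rw [mul_comm]
    congr 2
    ext j
    simp [Pi.single_apply, eq_comm]
  apply hfb
  rw [hdot]
  apply h
  ext j
  have : f (M *ᵥ Pi.single j 1) = 0 := by
    have : f (M *ᵥ Pi.single j 1) ∈ (LinearMap.range M.mulVecLin).map f :=
      Submodule.mem_map_of_mem ⟨_, rfl⟩
    rw [hf] at this
    exact (Submodule.mem_bot K).mp this
  rw [hdot, Matrix.dotProduct_mulVec] at this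
  simpa using this

section Finite

variable {V : Type*} [Fintype V] [DecidableEq V]

/-- Every function on an independent set of edges is a coboundary. -/
theorem EdgeIndependent.exists_coboundary_eq {F : Finset (Sym2 V)} (hF : EdgeIndependent F)
    (t : Sym2 V → ZMod 2) :
    ∃ l : V → ZMod 2, ∀ e ∈ F, ∑ u, (if u ∈ e then l u else 0) = t e := by
  obtain ⟨l, hl⟩ := Matrix.exists_mulVec_eq_of_forall_vecMul_eq_zero
    (Matrix.of fun (e : F) (u : V) => if u ∈ (e : Sym2 V) then (1 : ZMod 2) else 0)
    (fun e => t e) (by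
      intro y hy
      let x : Sym2 V → ZMod 2 := fun e => if h : e ∈ F then y ⟨e, h⟩ else 0
      have hZ : F.filter (x · = 1) = ∅ := by
        apply hF _ (Finset.filter_subset _ _)
        intro u
        rw [← ZMod.natCast_eq_zero_iff_even, natCast_edgeDegree_filter, ← Finset.sum_coe_sort]
        have := congrFun hy u
        simp only [Matrix.vecMul, dotProduct, Matrix.of_apply, mul_ite, mul_one, mul_zero,
          Pi.zero_apply] at this
        refine Eq.trans (Finset.sum_congr rfl fun e _ => ?_) this
        simp [x]
      have hy0 : y = 0 := by
        ext e
        have h2 : ∀ a : ZMod 2, a ≠ 1 → a = 0 := by decide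
        apply h2
        have := Finset.filter_eq_empty_iff.mp hZ e.2
        simpa [x] using this
      simp [hy0])
  refine ⟨l, fun e he => ?_⟩
  have := congrFun hl ⟨e, he⟩
  simpa [Matrix.mulVec, dotProduct] using this

/-- An independent set of edges splits into two parts, one of which contains every edge at `v`,
such that at the other vertices all degrees of both parts are zero or odd. -/
theorem EdgeIndependent.exists_rooted_partition {F : Finset (Sym2 V)} (hF : EdgeIndependent F)
    (hd : ∀ e ∈ F, ¬ e.IsDiag) (v : V) :
    ∃ R ⊆ F, (∀ e ∈ F, v ∈ e → e ∈ R) ∧ ∀ u ≠ v,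
      (edgeDegree R u = 0 ∨ Odd (edgeDegree R u)) ∧
      (edgeDegree (F \ R) u = 0 ∨ Odd (edgeDegree (F \ R) u)) := by
  classical
  have hmark : ∃ m : V → Finset (Sym2 V), m v = ∅ ∧ (∀ u, m u ⊆ F.filter (u ∈ ·)) ∧
      ∀ u ≠ v, edgeDegree F u = 0 ∨
        (Odd (edgeDegree F u) ∧ m u = ∅) ∨ (Even (edgeDegree F u) ∧ (m u).card = 1) := by
    have : ∀ u, ∃ s ⊆ F.filter (u ∈ ·), (u = v → s = ∅) ∧ (u ≠ v → edgeDegree F u = 0 ∨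
        (Odd (edgeDegree F u) ∧ s = ∅) ∨ (Even (edgeDegree F u) ∧ s.card = 1)) := by
      intro u
      by_cases huv : u = v
      · exact ⟨∅, by simp, by simp, by simp [huv]⟩
      rcases Nat.even_or_odd (edgeDegree F u) with h | h
      · rcases Nat.eq_zero_or_pos (edgeDegree F u) with h0 | h0
        · exact ⟨∅, by simp, by simp, by simp [h0]⟩
        · obtain ⟨e, he⟩ := Finset.card_pos.mp h0
          exact ⟨{e}, Finset.singleton_subset_iff.mpr he, by simp [huv], by simp [h]⟩
      · exact ⟨∅, by simp, by simp, by simp [h]⟩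
    choose m hm₁ hm₂ hm₃ using this
    exact ⟨m, hm₂ v rfl, hm₁, hm₃⟩
  obtain ⟨m, hmv, hmF, hm⟩ := hmark
  let c : V → Sym2 V → ZMod 2 := fun u e => if e ∈ m u then 1 else 0
  have hsum : ∀ (l : V → ZMod 2) (a b : V), a ≠ b →
      ∑ u, (if u ∈ s(a, b) then l u else 0) = l a + l b := by
    intro l a b hab
    rw [← Finset.sum_filter]
    have : Finset.univ.filter (· ∈ s(a, b)) = {a, b} := by ext; simp
    rw [this, Finset.sum_pair hab]
  obtain ⟨l, hl⟩ := hF.exists_coboundary_eq (fun e => ∑ u, if u ∈ e then c u e else 0)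
  let R := F.filter fun e => ∃ u ∈ e, l u + c u e = l v
  have hcompat : ∀ e ∈ F, ∀ u ∈ e, ∀ w ∈ e, l u + c u e = l w + c w e := by
    intro e he
    have hde := hd e he
    have hle := hl e he
    induction e using Sym2.ind with
    | _ a b =>
      have hab : a ≠ b := by simpa using hde
      rw [hsum _ _ _ hab, hsum (fun u => c u s(a, b)) _ _ hab] at hle
      have h2 : ∀ p q r s : ZMod 2, p + q = r + s → p + r = q + s := by decide
      have := h2 _ _ _ _ hle
      intro u hu w hw
      rcases Sym2.mem_iff.mp hu with rfl | rfl <;> rcases Sym2.mem_iff.mp hw with rfl | rfl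
      · rfl
      · exact this
      · exact this.symm
      · rfl
  have hR : ∀ e ∈ F, ∀ u ∈ e, (e ∈ R ↔ l u + c u e = l v) := by
    intro e he u hu
    simp only [R, Finset.mem_filter, he, true_and]
    constructor
    · rintro ⟨w, hw, h⟩
      rw [hcompat e he u hu w hw, h]
    · exact fun h => ⟨u, hu, h⟩
  have hRF : R ⊆ F := Finset.filter_subset _ _
  refine ⟨R, hRF, ?_, ?_⟩
  · intro e he hve
    rw [hR e he v hve]
    simp [c, hmv]
  · intro u huv
    have hadd := edgeDegree_sdiff_add hRF u
    have hmu : ∀ e ∈ m u, e ∈ F ∧ u ∈ e := fun e he => Finset.mem_filter.mp (hmF u he)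
    have hcases : edgeDegree R u = (m u).card ∨ edgeDegree (F \ R) u = (m u).card := by
      unfold edgeDegree
      by_cases hlu : l u = l v
      · right
        congr 1
        ext e
        simp only [Finset.mem_filter, Finset.mem_sdiff]
        constructor
        · rintro ⟨⟨he, heR⟩, hu⟩
          rw [hR e he u hu] at heR
          by_contra hem
          simp [c, hem, hlu] at heR
        · intro hem
          obtain ⟨he, hu⟩ := hmu e hem
          refine ⟨⟨he, ?_⟩, hu⟩
          rw [hR e he u hu]
          simp [c, hem, hlu]
      · left
        congr 1
        ext e
        simp only [Finset.mem_filter]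
        constructor
        · rintro ⟨heR, hu⟩
          rw [hR e (hRF heR) u hu] at heR
          by_contra hem
          simp [c, hem, hlu] at heR
        · intro hem
          obtain ⟨he, hu⟩ := hmu e hem
          refine ⟨?_, hu⟩
          rw [hR e he u hu]
          have h2 : ∀ p q : ZMod 2, p ≠ q → p + 1 = q := by decide
          simpa [c, hem] using h2 _ _ hlu
    simp only [Nat.odd_iff, Nat.even_iff] at hm ⊢
    rcases hm u huv with h | ⟨h, hc⟩ | ⟨h, hc⟩
    · omega
    · rw [hc, Finset.card_empty] at hcases
      omega
    · rw [hc] at hcases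
      omega

/-- A partition of an independent set of edges, as in `EdgeIndependent.exists_rooted_partition`,
where the part with the edges at `v` is named according to the parity of the degree at `v`. -/
theorem EdgeIndependent.exists_partition {F : Finset (Sym2 V)} (hF : EdgeIndependent F)
    (hd : ∀ e ∈ F, ¬ e.IsDiag) (v : V) :
    ∃ P Q : Finset (Sym2 V), P ∪ Q = F ∧ Disjoint P Q ∧
      (∀ u ≠ v, (edgeDegree P u = 0 ∨ Odd (edgeDegree P u)) ∧
        (edgeDegree Q u = 0 ∨ Odd (edgeDegree Q u))) ∧
      Even (edgeDegree P v) ∧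
      (edgeDegree Q v = 0 ∨ (Odd (edgeDegree Q v) ∧ Odd (edgeDegree F v))) := by
  obtain ⟨R, hRF, hv, hu⟩ := hF.exists_rooted_partition hd v
  have h0 : edgeDegree (F \ R) v = 0 := by
    apply edgeDegree_eq_zero
    intro e he hve
    rw [Finset.mem_sdiff] at he
    exact he.2 (hv e he.1 hve)
  have hadd := edgeDegree_sdiff_add hRF v
  rw [h0, zero_add] at hadd
  rcases Nat.even_or_odd (edgeDegree F v) with h | h
  · exact ⟨R, F \ R, Finset.union_sdiff_of_subset hRF, Finset.disjoint_sdiff, hu,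
      hadd ▸ h, Or.inl h0⟩
  · exact ⟨F \ R, R, Finset.sdiff_union_of_subset hRF, Finset.sdiff_disjoint,
      fun u hne => (hu u hne).symm, h0 ▸ Even.zero, Or.inr ⟨hadd ▸ h, h⟩⟩

variable {G : SimpleGraph V} {S T : Finset V} {v : V}

/-- A connected graph that is the union of its subgraphs induced by `S` and `T`, meeting only in
`v`: the edges in `S` contain a subset whose degrees at the vertices of `S` have any prescribed
parities `t` of even total. -/
theorem exists_edgeDegree_eq (hG : G.Connected) [DecidableRel G.Adj]
    (hvS : v ∈ S) (hinter : ∀ u, u ∈ S → u ∈ T → u = v)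
    (hedge : ∀ a b, G.Adj a b → (a ∈ S ∧ b ∈ S) ∨ (a ∈ T ∧ b ∈ T))
    (t : V → ZMod 2) (ht : ∑ u ∈ S, t u = 0) :
    ∃ F ⊆ G.edgeFinset.filter (fun e => ∀ u ∈ e, u ∈ S),
      ∀ u ∈ S, (edgeDegree F u : ZMod 2) = t u := by
  set E := G.edgeFinset.filter (fun e => ∀ u ∈ e, u ∈ S) with hE
  obtain ⟨x, hx⟩ := Matrix.exists_mulVec_eq_of_forall_vecMul_eq_zero
    (Matrix.of fun (u : S) (e : E) => if (u : V) ∈ (e : Sym2 V) then (1 : ZMod 2) else 0)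
    (fun u => t u) (by
      intro y hy
      let l : V → ZMod 2 := fun u => if h : u ∈ S then y ⟨u, h⟩ else y ⟨v, hvS⟩
      have hlT : ∀ u ∈ T, l u = y ⟨v, hvS⟩ := by
        intro u hu
        by_cases h : u ∈ S
        · obtain rfl := hinter u h hu
          simp [l, h]
        · simp [l, h]
      have hadj : ∀ a b, G.Adj a b → l a = l b := by
        intro a b hab
        rcases hedge a b hab with ⟨ha, hb⟩ | ⟨ha, hb⟩
        · have hmem : s(a, b) ∈ E := by
            simp [hE, hab, ha, hb]
          have := congrFun hy ⟨_, hmem⟩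
          simp only [Matrix.vecMul, dotProduct, Matrix.of_apply, mul_ite, mul_one, mul_zero,
            Pi.zero_apply] at this
          have h' : ∑ u ∈ S, (if u ∈ s(a, b) then l u else 0) = 0 := by
            rw [← Finset.sum_coe_sort]
            refine Eq.trans (Finset.sum_congr rfl fun u _ => ?_) this
            simp [l]
          rw [← Finset.sum_filter] at h'
          have hf : S.filter (· ∈ s(a, b)) = {a, b} := by
            ext w
            simp only [Finset.mem_filter, Sym2.mem_iff, Finset.mem_insert, Finset.mem_singleton]
            constructor
            · exact fun h => h.2
            · rintro (rfl | rfl) <;> simp [*]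
          rw [hf, Finset.sum_pair hab.ne] at h'
          have h2 : ∀ p q : ZMod 2, p + q = 0 → p = q := by decide
          exact h2 _ _ h'
        · rw [hlT a ha, hlT b hb]
      have hconst : ∀ a b, l a = l b := by
        intro a b
        obtain ⟨p⟩ := hG.preconnected a b
        induction p with
        | nil => rfl
        | cons h _ ih => exact (hadj _ _ h).trans ih
      have hy' : ∀ u : S, y u = y ⟨v, hvS⟩ := by
        intro u
        have := hconst u v
        simpa [l, hvS] using this
      simp only [dotProduct]
      rw [Finset.sum_congr rfl fun u _ => by rw [hy' u], ← Finset.mul_sum,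
        Finset.sum_coe_sort S t, ht, mul_zero])
  let z : Sym2 V → ZMod 2 := fun e => if h : e ∈ E then x ⟨e, h⟩ else 0
  refine ⟨E.filter (z · = 1), Finset.filter_subset _ _, fun u hu => ?_⟩
  rw [natCast_edgeDegree_filter]
  have := congrFun hx ⟨u, hu⟩
  simp only [Matrix.mulVec, dotProduct, Matrix.of_apply, ite_mul, one_mul, zero_mul] at this
  rw [← this, ← Finset.sum_coe_sort]
  refine Finset.sum_congr rfl fun e _ => ?_
  simp [z]

/-- In the situation of `exists_edgeDegree_eq`, if `S` has even size, there is a set `F` of edges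
in `S` whose complement is odd at all vertices of `S`, and which stays independent after adding
one edge. -/
theorem exists_independent_with_odd_complement (hG : G.Connected) [DecidableRel G.Adj]
    (hvS : v ∈ S) (hinter : ∀ u, u ∈ S → u ∈ T → u = v)
    (hedge : ∀ a b, G.Adj a b → (a ∈ S ∧ b ∈ S) ∨ (a ∈ T ∧ b ∈ T)) (hS : Even S.card) :
    ∃ F ⊆ G.edgeFinset.filter (fun e => ∀ u ∈ e, u ∈ S),
      (∀ u ∈ S, Odd (edgeDegree (G.edgeFinset.filter (fun e => ∀ u ∈ e, u ∈ S) \ F) u)) ∧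
      ∀ A ⊆ G.edgeFinset.filter (fun e => ∀ u ∈ e, u ∈ S), (A \ F).card ≤ 1 →
        EdgeIndependent A := by
  set E := G.edgeFinset.filter (fun e => ∀ u ∈ e, u ∈ S) with hE
  have hdiag : ∀ e ∈ E, ¬ e.IsDiag := fun e he =>
    G.not_isDiag_of_mem_edgeSet (SimpleGraph.mem_edgeFinset.mp (Finset.mem_filter.mp he).1)
  have hdeg : ∑ u ∈ S, edgeDegree E u = 2 * E.card := by
    unfold edgeDegree
    simp_rw [Finset.card_filter]
    rw [Finset.sum_comm, Finset.card_eq_sum_ones, Finset.mul_sum]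
    refine Finset.sum_congr rfl fun e he => ?_
    have hde := hdiag e he
    have hS := (Finset.mem_filter.mp he).2
    rw [← Finset.card_filter]
    induction e using Sym2.ind with
    | _ a b =>
      have hab : a ≠ b := by simpa using hde
      have hf : S.filter (· ∈ s(a, b)) = {a, b} := by
        ext w
        simp only [Finset.mem_filter, Sym2.mem_iff, Finset.mem_insert, Finset.mem_singleton]
        constructor
        · exact fun h => h.2
        · exact fun h => ⟨hS w (Sym2.mem_iff.mpr h), h⟩
      rw [hf, Finset.card_pair hab, mul_one]
  have hsum : ∑ u ∈ S, ((edgeDegree E u : ZMod 2) + 1) = 0 := by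
    rw [Finset.sum_add_distrib, ← Nat.cast_sum, hdeg, Finset.sum_const, nsmul_one,
      (ZMod.natCast_eq_zero_iff_even).mpr hS, (ZMod.natCast_eq_zero_iff_even).mpr (by simp),
      add_zero]
  obtain ⟨F₀, hF₀E, hF₀⟩ := exists_edgeDegree_eq hG hvS hinter hedge _ hsum
  obtain ⟨F, hF, hmin⟩ := Finset.exists_min_image
    (E.powerset.filter fun F => ∀ u ∈ S, (edgeDegree F u : ZMod 2) = edgeDegree E u + 1)
    Finset.card ⟨F₀, Finset.mem_filter.mpr ⟨Finset.mem_powerset.mpr hF₀E, hF₀⟩⟩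
  rw [Finset.mem_filter, Finset.mem_powerset] at hF
  obtain ⟨hFE, hFd⟩ := hF
  refine ⟨F, hFE, ?_, ?_⟩
  · intro u hu
    have h₁ := hFd u hu
    rw [← edgeDegree_sdiff_add hFE u, ← Nat.cast_add_one, ZMod.natCast_eq_natCast_iff'] at h₁
    rw [Nat.odd_iff]
    omega
  · intro A hAE hAF Z hZA hZ
    by_contra hne
    have hlt := two_lt_card_of_even_edgeDegree (Finset.nonempty_iff_ne_empty.mpr hne)
      (fun e he => hdiag e (hAE (hZA he))) hZ
    have hle := hmin (symmDiff F Z) (by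
      rw [Finset.mem_filter, Finset.mem_powerset]
      constructor
      · intro e he
        rcases Finset.mem_symmDiff.mp he with h | h
        · exact hFE h.1
        · exact hAE (hZA h.1)
      · intro u hu
        rw [← hFd u hu, ZMod.natCast_eq_natCast_iff']
        have := edgeDegree_symmDiff_add_inter F Z u
        obtain ⟨k, hk⟩ := hZ u
        omega)
    have h₁ : (symmDiff F Z).card = (F \ Z).card + (Z \ F).card :=
      Finset.card_union_of_disjoint disjoint_sdiff_sdiff
    have h₂ := Finset.card_sdiff_add_card_inter F Z
    have h₃ := Finset.card_sdiff_add_card_inter Z F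
    have h₄ : (Z \ F).card ≤ (A \ F).card :=
      Finset.card_le_card (Finset.sdiff_subset_sdiff hZA subset_rfl)
    rw [Finset.inter_comm] at h₃
    omega

/-- A connected graph that is the union of two subgraphs induced by sets `S` and `T` of even size
meeting only in `v` has an odd 3-edge-covering with overlap at most 2. -/
theorem exists_odd_three_edge_covering (hG : G.Connected) [DecidableRel G.Adj]
    (hvS : v ∈ S) (hvT : v ∈ T) (hinter : ∀ u, u ∈ S → u ∈ T → u = v)
    (hunion : ∀ u, u ∈ S ∨ u ∈ T)
    (hedge : ∀ a b, G.Adj a b → (a ∈ S ∧ b ∈ S) ∨ (a ∈ T ∧ b ∈ T))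
    (hS : Even S.card) (hT : Even T.card) :
    ∃ X : Fin 3 → Finset (Sym2 V),
      (∀ j, X j ⊆ G.edgeFinset) ∧
      (∀ e ∈ G.edgeFinset, ∃ j, e ∈ X j) ∧
      (∀ j u, edgeDegree (X j) u = 0 ∨ Odd (edgeDegree (X j) u)) ∧
      ∃ A : Finset (Sym2 V), A.card ≤ 1 ∧ ∀ e,
        (Finset.univ.filter (e ∈ X ·)).card ≤ if e ∈ A then 2 else 1 := by
  obtain ⟨F₁, hF₁E, hH₁, hind₁⟩ :=
    exists_independent_with_odd_complement hG hvS hinter hedge hS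
  obtain ⟨F₂, hF₂E, hH₂, hind₂⟩ :=
    exists_independent_with_odd_complement hG hvT (fun u h₁ h₂ => hinter u h₂ h₁)
      (fun a b h => (hedge a b h).symm) hT
  set E₁ := G.edgeFinset.filter (fun e => ∀ u ∈ e, u ∈ S) with hE₁
  set E₂ := G.edgeFinset.filter (fun e => ∀ u ∈ e, u ∈ T) with hE₂
  have hdiag : ∀ e ∈ G.edgeFinset, ¬ e.IsDiag := fun e he =>
    G.not_isDiag_of_mem_edgeSet (SimpleGraph.mem_edgeFinset.mp he)
  have hE₁G : E₁ ⊆ G.edgeFinset := Finset.filter_subset _ _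
  have hE₂G : E₂ ⊆ G.edgeFinset := Finset.filter_subset _ _
  have hcover : ∀ e ∈ G.edgeFinset, e ∈ E₁ ∨ e ∈ E₂ := by
    intro e he
    simp only [hE₁, hE₂, Finset.mem_filter, he, true_and]
    induction e using Sym2.ind with
    | _ a b => simpa using hedge a b (by simpa using he)
  have hdisj : Disjoint E₁ E₂ := by
    rw [Finset.disjoint_left]
    intro e h₁ h₂
    have hde := hdiag e (hE₁G h₁)
    have h₁ := (Finset.mem_filter.mp h₁).2
    have h₂ := (Finset.mem_filter.mp h₂).2
    have hv : ∀ u ∈ e, u = v := fun u hu => hinter u (h₁ u hu) (h₂ u hu)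
    induction e using Sym2.ind with
    | _ a b => exact hde (by simp [hv a (by simp), hv b (by simp)])
  obtain ⟨K, hFK, hKE, hKF, hKv⟩ : ∃ K, F₁ ⊆ K ∧ K ⊆ E₁ ∧ (K \ F₁).card ≤ 1 ∧
      ¬ (Odd (edgeDegree K v) ∧ Odd (edgeDegree F₂ v)) := by
    by_cases hodd : Odd (edgeDegree F₁ v)
    · have hlt : 0 < edgeDegree (E₁ \ F₁) v := (hH₁ v hvS).pos
      obtain ⟨e, he⟩ := Finset.card_pos.mp hlt
      rw [Finset.mem_filter, Finset.mem_sdiff] at he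
      obtain ⟨⟨heE, heF⟩, hve⟩ := he
      refine ⟨insert e F₁, Finset.subset_insert _ _,
        Finset.insert_subset heE hF₁E, ?_, ?_⟩
      · rw [Finset.insert_sdiff_of_notMem _ heF, Finset.sdiff_self]
        simp
      · rw [edgeDegree_insert_self heF hve]
        rintro ⟨h, -⟩
        rw [Nat.odd_iff] at h hodd
        omega
    · exact ⟨F₁, subset_rfl, hF₁E, by simp, fun h => hodd h.1⟩
  obtain ⟨P₁, Q₁, hPQ₁, hdPQ₁, hu₁, hP₁, hQ₁⟩ :=
    (hind₁ K hKE hKF).exists_partition (fun e he => hdiag e (hE₁G (hKE he))) v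
  obtain ⟨P₂, Q₂, hPQ₂, hdPQ₂, hu₂, hP₂, hQ₂⟩ :=
    (hind₂ F₂ hF₂E (by simp)).exists_partition (fun e he => hdiag e (hE₂G (hF₂E he))) v
  have hP₁E : P₁ ⊆ E₁ := Finset.subset_union_left.trans (hPQ₁.subset.trans hKE)
  have hQ₁E : Q₁ ⊆ E₁ := Finset.subset_union_right.trans (hPQ₁.subset.trans hKE)
  have hP₂E : P₂ ⊆ E₂ := Finset.subset_union_left.trans (hPQ₂.subset.trans hF₂E)
  have hQ₂E : Q₂ ⊆ E₂ := Finset.subset_union_right.trans (hPQ₂.subset.trans hF₂E)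
  have hH₁E : E₁ \ F₁ ⊆ E₁ := Finset.sdiff_subset
  have hH₂E : E₂ \ F₂ ⊆ E₂ := Finset.sdiff_subset
  have hX₀ := edgeDegree_union_of_disjoint (hdisj.mono hH₁E hP₂E)
  have hX₁ := edgeDegree_union_of_disjoint (hdisj.mono hP₁E hH₂E)
  have hX₂ := edgeDegree_union_of_disjoint (hdisj.mono hQ₁E hQ₂E)
  have hz₁ : ∀ A ⊆ E₁, ∀ u ∉ S, edgeDegree A u = 0 := fun A hA u hu =>
    edgeDegree_eq_zero fun e he hue => hu ((Finset.mem_filter.mp (hA he)).2 u hue)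
  have hz₂ : ∀ A ⊆ E₂, ∀ u ∉ T, edgeDegree A u = 0 := fun A hA u hu =>
    edgeDegree_eq_zero fun e he hue => hu ((Finset.mem_filter.mp (hA he)).2 u hue)
  refine ⟨![(E₁ \ F₁) ∪ P₂, P₁ ∪ (E₂ \ F₂), Q₁ ∪ Q₂], ?_, ?_, ?_, K \ F₁, hKF, ?_⟩
  · intro j
    fin_cases j
    · exact Finset.union_subset (hH₁E.trans hE₁G) (hP₂E.trans hE₂G)
    · exact Finset.union_subset (hP₁E.trans hE₁G) (hH₂E.trans hE₂G)
    · exact Finset.union_subset (hQ₁E.trans hE₁G) (hQ₂E.trans hE₂G)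
  · intro e he
    have h₁ : e ∈ F₁ → e ∈ P₁ ∨ e ∈ Q₁ := fun h =>
      Finset.mem_union.mp (hPQ₁.symm ▸ hFK h)
    have h₂ : e ∈ F₂ → e ∈ P₂ ∨ e ∈ Q₂ := fun h => Finset.mem_union.mp (hPQ₂.symm ▸ h)
    rcases hcover e he with hE | hE
    · by_cases hF : e ∈ F₁
      · rcases h₁ hF with h | h
        · exact ⟨1, Finset.mem_union_left _ h⟩
        · exact ⟨2, Finset.mem_union_left _ h⟩
      · exact ⟨0, Finset.mem_union_left _ (Finset.mem_sdiff.mpr ⟨hE, hF⟩)⟩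
    · by_cases hF : e ∈ F₂
      · rcases h₂ hF with h | h
        · exact ⟨0, Finset.mem_union_right _ h⟩
        · exact ⟨2, Finset.mem_union_right _ h⟩
      · exact ⟨1, Finset.mem_union_right _ (Finset.mem_sdiff.mpr ⟨hE, hF⟩)⟩
  · have key : ∀ u, (edgeDegree ((E₁ \ F₁) ∪ P₂) u = 0 ∨ Odd (edgeDegree ((E₁ \ F₁) ∪ P₂) u)) ∧
        (edgeDegree (P₁ ∪ (E₂ \ F₂)) u = 0 ∨ Odd (edgeDegree (P₁ ∪ (E₂ \ F₂)) u)) ∧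
        (edgeDegree (Q₁ ∪ Q₂) u = 0 ∨ Odd (edgeDegree (Q₁ ∪ Q₂) u)) := by
      intro u
      rw [hX₀, hX₁, hX₂]
      by_cases huv : u = v
      · subst huv
        have h₁ := hH₁ u hvS
        have h₂ := hH₂ u hvT
        simp only [Nat.odd_iff, Nat.even_iff] at *
        omega
      · by_cases hu : u ∈ S
        · have huT : u ∉ T := fun h => huv (hinter u hu h)
          simp only [hz₂ _ hP₂E u huT, hz₂ _ hH₂E u huT, hz₂ _ hQ₂E u huT, add_zero]
          exact ⟨Or.inr (hH₁ u hu), hu₁ u huv⟩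
        · simp only [hz₁ _ hP₁E u hu, hz₁ _ hH₁E u hu, hz₁ _ hQ₁E u hu, zero_add]
          exact ⟨(hu₂ u huv).1, Or.inr (hH₂ u ((hunion u).resolve_left hu)), (hu₂ u huv).2⟩
    intro j u
    fin_cases j
    · exact (key u).1
    · exact (key u).2.1
    · exact (key u).2.2
  · intro e
    have hPQK : e ∈ P₁ ∨ e ∈ Q₁ ↔ e ∈ K := by rw [← hPQ₁, Finset.mem_union]
    have hPQF : e ∈ P₂ ∨ e ∈ Q₂ ↔ e ∈ F₂ := by rw [← hPQ₂, Finset.mem_union]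
    have hd : e ∈ E₁ → e ∉ E₂ := fun h => Finset.disjoint_left.mp hdisj h
    have hd₁ : e ∈ P₁ → e ∉ Q₁ := fun h => Finset.disjoint_left.mp hdPQ₁ h
    have hd₂ : e ∈ P₂ → e ∉ Q₂ := fun h => Finset.disjoint_left.mp hdPQ₂ h
    have hFK := @hFK e
    have hKE := @hKE e
    have hF₂E := @hF₂E e
    rw [Finset.card_filter, Fin.sum_univ_three]
    simp only [Matrix.cons_val_zero, Matrix.cons_val_one, Matrix.cons_val, Finset.mem_union,
      Finset.mem_sdiff]
    by_cases he : e ∈ E₁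
    · have he₂ := hd he
      have heF₂ : e ∉ F₂ := fun h => he₂ (hF₂E h)
      have heP₂ : e ∉ P₂ := fun h => heF₂ (hPQF.mp (Or.inl h))
      have heQ₂ : e ∉ Q₂ := fun h => heF₂ (hPQF.mp (Or.inr h))
      simp only [he, he₂, heP₂, heQ₂, ← hPQK, true_and, false_and, or_false]
      rw [← hPQK] at hFK
      clear * - hd₁ hFK
      by_cases hF : e ∈ F₁ <;> by_cases hP : e ∈ P₁ <;> by_cases hQ : e ∈ Q₁ <;>
        simp_all
    · have heK : e ∉ K := fun h => he (hKE h)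
      have heP₁ : e ∉ P₁ := fun h => heK (hPQK.mp (Or.inl h))
      have heQ₁ : e ∉ Q₁ := fun h => heK (hPQK.mp (Or.inr h))
      simp only [he, heK, heP₁, heQ₁, ← hPQF, false_and, false_or]
      clear * - hd₂
      by_cases hE : e ∈ E₂ <;> by_cases hP : e ∈ P₂ <;> by_cases hQ : e ∈ Q₂ <;>
        simp_all

end Finite

/-- Let `G` be a connected simple graph of odd order with a cut vertex `v` such that
`G − v` has a connected component of odd order. Then `G` has an odd 3-edge-covering
with overlap at most 2. -/
theorem stmt_14 {V : Type*} [Fintype V] [DecidableEq V] (G : SimpleGraph V)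
    [DecidableRel G.Adj]
    (hG : G.Connected) (hodd : Odd (Fintype.card V)) (v : V)
    (hcut : ¬ (G.induce ({v}ᶜ : Set V)).Connected)
    (hcomp : ∃ c : (G.induce ({v}ᶜ : Set V)).ConnectedComponent, Odd c.supp.ncard) :
    ∃ ψ : Sym2 V → Finset (Fin 3),
      (∀ e ∈ G.edgeSet, (ψ e).Nonempty) ∧
      (∀ (j : Fin 3) (u : V),
        {e | e ∈ G.edgeSet ∧ j ∈ ψ e ∧ u ∈ e}.ncard = 0 ∨
          Odd {e | e ∈ G.edgeSet ∧ j ∈ ψ e ∧ u ∈ e}.ncard) ∧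
      (∑ e ∈ G.edgeFinset, (if 2 ≤ (ψ e).card then (ψ e).card else 0)) ≤ 2 := by
  classical
  obtain ⟨c, hc⟩ := hcomp
  let C : Finset V := (Subtype.val '' c.supp).toFinset
  have hC : ∀ u, u ∈ C ↔ ∃ h : u ≠ v, (G.induce ({v}ᶜ : Set V)).connectedComponentMk ⟨u, h⟩ = c := by
    intro u
    simp [C]
  have hvC : v ∉ C := by simp [hC]
  have hCcard : Odd C.card := by
    rwa [← Set.ncard_eq_toFinset_card', Set.ncard_image_of_injective _ Subtype.val_injective]
  have hclosed : ∀ a b, G.Adj a b → a ∈ C → b ≠ v → b ∈ C := by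
    intro a b hab ha hb
    obtain ⟨hav, hac⟩ := (hC a).mp ha
    refine (hC b).mpr ⟨hb, ?_⟩
    rw [← hac]
    exact SimpleGraph.ConnectedComponent.connectedComponentMk_eq_of_adj
      (by simpa using hab.symm)
  obtain ⟨X, hXG, hcov, hXd, A, hA, hXA⟩ :=
    exists_odd_three_edge_covering (S := insert v C) (T := Cᶜ) (v := v) hG
      (by simp) (by simpa using hvC)
      (fun u h₁ h₂ => (Finset.mem_insert.mp h₁).resolve_right (Finset.mem_compl.mp h₂))
      (fun u => by by_cases h : u ∈ C <;> simp [h])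
      (fun a b hab => by
        have h₁ := hclosed a b hab
        have h₂ := hclosed b a hab.symm
        simp only [Finset.mem_insert, Finset.mem_compl]
        by_cases ha : a = v <;> by_cases hb : b = v <;> by_cases haC : a ∈ C <;>
          by_cases hbC : b ∈ C <;> simp_all)
      (by rw [Finset.card_insert_of_notMem hvC]; exact hCcard.add_one)
      (by rw [Finset.card_compl]; exact Nat.Odd.sub_odd hodd hCcard)
  refine ⟨fun e => Finset.univ.filter (e ∈ X ·), ?_, ?_, ?_⟩
  · intro e he
    obtain ⟨j, hj⟩ := hcov e (SimpleGraph.mem_edgeFinset.mpr he)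
    exact ⟨j, by simp [hj]⟩
  · intro j u
    have : {e | e ∈ G.edgeSet ∧ j ∈ Finset.univ.filter (e ∈ X ·) ∧ u ∈ e} =
        ((X j).filter (u ∈ ·) : Finset (Sym2 V)) := by
      ext e
      simp only [Set.mem_ofPred_eq, Finset.mem_filter, Finset.mem_univ, true_and, Finset.coe_filter]
      exact ⟨fun h => h.2, fun h => ⟨SimpleGraph.mem_edgeFinset.mp (hXG j h.1), h⟩⟩
    rw [this, Set.ncard_coe_finset]
    exact hXd j u
  · calc _ ≤ ∑ e ∈ G.edgeFinset, (if e ∈ A then 2 else 0) := by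
          refine Finset.sum_le_sum fun e _ => ?_
          have := hXA e
          dsimp only
          split_ifs at this ⊢ <;> omega
      _ ≤ 2 := by
          rw [← Finset.sum_filter, Finset.sum_const, smul_eq_mul]
          have : (G.edgeFinset.filter (· ∈ A)).card ≤ A.card :=
            Finset.card_le_card fun e he => (Finset.mem_filter.mp he).2
          omega
end
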